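/- For every half-integral vector y ∈ {0, 1/2, 1}^m, the inequality ρ_A(y) ≤ 4 · max{|z| : z ∈ P, z ≤ y} holds. Moreover, if there exists an extreme point z* of P with z* ≤ y that attains this maximum, then equality holds: ρ_A(y) = 4 · max{|z| : z ∈ P, z ≤ y}. -/

import Mathlib

open Matrix

noncomputable section

/-- Wedge product `a ∧ b = a bᵀ − b aᵀ`. -/
def wedge {K : Type*} [Field K] {n : ℕ} (a b : Fin n → K) : Matrix (Fin n) (Fin n) K :=
  vecMulVec a b - vecMulVec b a

/-- The line spanned by `a` and `b`. -/
def line {K : Type*} [Field K] {n : ℕ} (a b : Fin n → K) : Submodule K (Fin n → K) :=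
  Submodule.span K {a, b}

/-- `y` is a fractional matroid matching for the lines `ℓᵢ = span {aᵢ, bᵢ}`. -/
def IsFracMatching {K : Type*} [Field K] {n m : ℕ} (a b : Fin m → Fin n → K)
    (y : Fin m → ℝ) : Prop :=
  (∀ i, 0 ≤ y i) ∧ ∀ S : Submodule K (Fin n → K),
    ∑ i, (Module.finrank K ↥(S ⊓ line (a i) (b i)) : ℝ) * y i ≤ (Module.finrank K ↥S : ℝ)

/-- The rational function field generated over `K` by the entries of the `2 × 2`
indeterminate matrices `U₁, …, U_m`. -/
abbrev FF2 (K : Type*) [Field K] (m : ℕ) : Type _ :=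
  FractionRing (MvPolynomial (Fin m × Fin 2 × Fin 2) K)

/-- The indeterminate `(Uᵢ)_{p,c}` as an element of `FF2 K m`. -/
def Uvar {K : Type*} [Field K] {m : ℕ} (i : Fin m) (p c : Fin 2) : FF2 K m :=
  algebraMap (MvPolynomial (Fin m × Fin 2 × Fin 2) K) (FF2 K m) (MvPolynomial.X (i, p, c))

def toFF2 (K : Type*) [Field K] (m : ℕ) : K →+* FF2 K m :=
  (algebraMap (MvPolynomial (Fin m × Fin 2 × Fin 2) K) (FF2 K m)).comp MvPolynomial.C

/-- The `n × 2` matrix `Bᵢ = [aᵢ bᵢ]`. -/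
def colMat {K : Type*} [Field K] {n : ℕ} (a b : Fin n → K) : Matrix (Fin n) (Fin 2) K :=
  Matrix.of fun r j => if j = 0 then a r else b r

/-- The matrix `B(z) = [U₁ ⊗ B₁ ⋯ U_m ⊗ B_m]`, where the half-integral vector `z` is
encoded by `s : Fin m → ℕ` with `sᵢ = 2 zᵢ ∈ {0, 1, 2}`, and `Uᵢ` is a `2 × sᵢ` matrix of
distinct indeterminates.  The unused columns (those with `c ≥ sᵢ`) are padded with zeros,
so that `B(z)` has full column rank iff this matrix has rank `∑ᵢ 2 sᵢ = 4|z|`. -/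
def Bmat {K : Type*} [Field K] {n m : ℕ} (a b : Fin m → Fin n → K) (s : Fin m → ℕ) :
    Matrix (Fin 2 × Fin n) (Fin m × Fin 2 × Fin 2) (FF2 K m) :=
  Matrix.of fun pr icj =>
    if (icj.2.1 : ℕ) < s icj.1 then
      Uvar icj.1 pr.1 icj.2.1 * toFF2 K m (colMat (a icj.1) (b icj.1) pr.2 icj.2.2)
    else 0

/-- The `2 × 2` matrix `Yᵢ = Uᵢ Uᵢᵀ`, where `Uᵢ` is a `2 × sᵢ` matrix of indeterminates. -/
def Ymat {K : Type*} [Field K] {m : ℕ} (s : Fin m → ℕ) (i : Fin m) :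
    Matrix (Fin 2) (Fin 2) (FF2 K m) :=
  Matrix.of fun p q => ∑ c : Fin 2, if (c : ℕ) < s i then Uvar i p c * Uvar i q c else 0

/-- The matrix `A^{(2)}(y) = ∑ᵢ (Uᵢ Uᵢᵀ) ⊗ (aᵢ ∧ bᵢ)`, where the half-integral vector `y`
is encoded by `t : Fin m → ℕ` with `tᵢ = 2 yᵢ ∈ {0, 1, 2}`. -/
def A2 {K : Type*} [Field K] {n m : ℕ} (a b : Fin m → Fin n → K) (t : Fin m → ℕ) :
    Matrix (Fin 2 × Fin n) (Fin 2 × Fin n) (FF2 K m) :=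
  ∑ i : Fin m,
    kroneckerMap (· * ·) (Ymat t i) ((wedge (a i) (b i)).map (toFF2 K m))

section SkewMatrices

variable {F ι : Type*} [Field F]

/-- The wedge product of two vectors indexed by an arbitrary type. -/
def skew (p q : ι → F) : Matrix ι ι F := vecMulVec p q - vecMulVec q p

theorem skew_transpose (p q : ι → F) : (skew p q)ᵀ = -skew p q := by
  simp [skew, transpose_sub, transpose_vecMulVec]

theorem skew_add_smul_left (p q : ι → F) (c : F) : skew (p + c • q) q = skew p q := by
  ext i j
  simp [skew, vecMulVec_apply]
  ring

theorem skew_swap (p q : ι → F) : skew p q = skew q (-p) := by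
  ext i j
  simp [skew, vecMulVec_apply]
  ring

theorem sum_skew_transpose {X : Type*} (J : Finset X) (v : X → Fin 2 → ι → F) :
    (∑ x ∈ J, skew (v x 0) (v x 1))ᵀ = -∑ x ∈ J, skew (v x 0) (v x 1) := by
  rw [transpose_sum, ← Finset.sum_neg_distrib]
  simp only [skew_transpose]

/-- Every subspace of a finite-dimensional space is the kernel of an endomorphism. -/
theorem exists_endomorphism_ker_eq {V : Type*} [AddCommGroup V] [Module F V]
    (S : Submodule F V) : ∃ φ : V →ₗ[F] V, LinearMap.ker φ = S := by
  obtain ⟨T, hT⟩ := S.exists_isCompl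
  refine ⟨T.subtype ∘ₗ T.projectionOnto S hT.symm, ?_⟩
  rw [LinearMap.ker_comp_of_ker_eq_bot _ T.ker_subtype]
  simp

variable [Fintype ι]

theorem rank_add_le_rank_add_rank (A B : Matrix ι ι F) : (A + B).rank ≤ A.rank + B.rank := by
  have h : LinearMap.range (A + B).mulVecLin ≤
      LinearMap.range A.mulVecLin ⊔ LinearMap.range B.mulVecLin := by
    rw [Matrix.mulVecLin_add]
    exact LinearMap.range_add_le _ _
  exact (Submodule.finrank_mono h).trans (Submodule.finrank_add_le_finrank_add_finrank _ _)

theorem rank_neg_eq (A : Matrix ι ι F) : (-A).rank = A.rank := by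
  have h : ∀ B : Matrix ι ι F, (-B).rank ≤ B.rank := fun B => by
    classical
    have : -B = B * (-1) := by simp
    rw [this]
    exact rank_mul_le_left _ _
  exact le_antisymm (h A) (by simpa using h (-A))

theorem rank_skew_le (p q : ι → F) : (skew p q).rank ≤ 2 := by
  rw [skew, sub_eq_add_neg]
  refine (rank_add_le_rank_add_rank _ _).trans ?_
  rw [rank_neg_eq]
  have h1 := rank_vecMulVec_le p q
  have h2 := rank_vecMulVec_le q p
  omega

theorem dotProduct_skew_mulVec (p q f : ι → F) : f ⬝ᵥ (skew p q *ᵥ f) = 0 := by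
  simp only [skew, sub_mulVec, vecMulVec_mulVec, dotProduct_sub]
  simp [dotProduct_comm f, mul_comm]

theorem mul_skew_mul_transpose (M : Matrix ι ι F) (p q : ι → F) :
    M * skew p q * Mᵀ = skew (M *ᵥ p) (M *ᵥ q) := by
  simp [skew, Matrix.mul_sub, Matrix.sub_mul, mul_vecMulVec, vecMulVec_mul, vecMul_transpose]

/-- Left multiplication by a matrix that is injective on the column space preserves the rank. -/
theorem rank_mul_eq_of_disjoint (M C : Matrix ι ι F)
    (h : Disjoint (LinearMap.ker M.mulVecLin) (LinearMap.range C.mulVecLin)) :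
    (M * C).rank = C.rank := by
  unfold Matrix.rank
  rw [mulVecLin_mul, LinearMap.range_comp]
  refine LinearEquiv.finrank_eq (LinearEquiv.ofInjective
    (M.mulVecLin.domRestrict (LinearMap.range C.mulVecLin)) ?_ ≪≫ₗ
      LinearEquiv.ofEq _ _ ?_) |>.symm
  · rw [← LinearMap.ker_eq_bot, LinearMap.ker_domRestrict, Submodule.eq_bot_iff]
    rintro ⟨x, hx⟩ hx'
    simpa using Submodule.disjoint_def.1 h x (by simpa using hx') hx
  · rw [LinearMap.range_domRestrict]

theorem rank_add_skew_le_of_mem_range (A : Matrix ι ι F) (hA : Aᵀ = -A)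
    (hA' : ∀ f, f ⬝ᵥ (A *ᵥ f) = 0) (p q : ι → F) (hp : p ∈ LinearMap.range A.mulVecLin) :
    (A + skew p q).rank ≤ A.rank := by
  classical
  obtain ⟨f, rfl⟩ := hp
  have h1 : f ᵥ* A = -(A *ᵥ f) := by
    rw [← mulVec_transpose, hA, neg_mulVec]
  have key : A + skew (A.mulVecLin f) q =
      (1 + vecMulVec q f) * A * (1 + vecMulVec f q) := by
    simp only [skew, mulVecLin_apply, Matrix.add_mul, Matrix.mul_add, Matrix.one_mul,
      Matrix.mul_one, mul_vecMulVec, vecMulVec_mul, h1]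
    have : vecMulVec q (A *ᵥ f) *ᵥ f = 0 := by
      simp [vecMulVec_mulVec, dotProduct_comm _ f, hA']
    rw [vecMulVec_neg, add_mulVec, neg_mulVec, this]
    ext i j
    simp [vecMulVec_apply]
    ring
  rw [key]
  exact (rank_mul_le_left _ _).trans (rank_mul_le_right _ _)

theorem rank_add_skew_le_of_combination (A : Matrix ι ι F) (hA : Aᵀ = -A)
    (hA' : ∀ f, f ⬝ᵥ (A *ᵥ f) = 0) (p q : ι → F) (c d : F) (hcd : c ≠ 0 ∨ d ≠ 0)
    (h : c • p + d • q ∈ LinearMap.range A.mulVecLin) :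
    (A + skew p q).rank ≤ A.rank := by
  rcases hcd with hc | hd
  · rw [← skew_add_smul_left p q (c⁻¹ * d)]
    refine rank_add_skew_le_of_mem_range A hA hA' _ _ ?_
    have := Submodule.smul_mem _ c⁻¹ h
    rwa [smul_add, smul_smul, smul_smul, inv_mul_cancel₀ hc, one_smul] at this
  · rw [skew_swap, ← skew_add_smul_left q (-p) (-(d⁻¹ * c))]
    refine rank_add_skew_le_of_mem_range A hA hA' _ _ ?_
    have := Submodule.smul_mem _ d⁻¹ h
    rw [smul_add, smul_smul, smul_smul, inv_mul_cancel₀ hd, one_smul, add_comm] at this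
    rwa [smul_neg, neg_smul, neg_neg]

/-- Among the lines spanned by the pairs `v x`, there are independent ones whose number is at
least half of the rank of the sum of the wedge products. -/
theorem exists_independent_lines {X : Type*} (J : Finset X) :
    ∀ v : X → Fin 2 → ι → F, ∃ M : Finset X, M ⊆ J ∧
      LinearIndependent F (fun x : M × Fin 2 => v x.1 x.2) ∧
      (∑ x ∈ J, skew (v x 0) (v x 1)).rank ≤ 2 * M.card := by
  classical
  induction J using Finset.induction_on with
  | empty => exact fun v => ⟨∅, by simp, linearIndependent_empty_type, by simp⟩
  | insert j J hj ih =>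
    intro v
    set A := ∑ x ∈ J, skew (v x 0) (v x 1) with hAdef
    have hA : Aᵀ = -A := sum_skew_transpose J v
    have hA' : ∀ f, f ⬝ᵥ (A *ᵥ f) = 0 := fun f => by
      rw [hAdef, sum_mulVec, dotProduct_sum]
      exact Finset.sum_eq_zero fun x _ => dotProduct_skew_mulVec _ _ _
    rw [Finset.sum_insert hj, add_comm, ← hAdef]
    by_cases hc : ∃ c d : F, (c ≠ 0 ∨ d ≠ 0) ∧
        c • v j 0 + d • v j 1 ∈ LinearMap.range A.mulVecLin
    · obtain ⟨c, d, hcd, h⟩ := hc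
      obtain ⟨M, hMJ, hM, hr⟩ := ih v
      exact ⟨M, hMJ.trans (Finset.subset_insert _ _), hM,
        (rank_add_skew_le_of_combination A hA hA' _ _ c d hcd h).trans hr⟩
    · have hzero : ∀ c d : F, c • v j 0 + d • v j 1 ∈ LinearMap.range A.mulVecLin →
          c = 0 ∧ d = 0 := by
        intro c d h
        by_contra hne
        exact hc ⟨c, d, by tauto, h⟩
      obtain ⟨φ, hφ⟩ := exists_endomorphism_ker_eq (Submodule.span F {v j 0, v j 1})
      set Φ := LinearMap.toMatrix' φ with hΦ
      have hΦφ : Φ.mulVecLin = φ := by rw [← toLin'_apply', hΦ, toLin'_toMatrix']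
      have hdisj : Disjoint (LinearMap.ker Φ.mulVecLin) (LinearMap.range A.mulVecLin) := by
        rw [hΦφ, hφ, Submodule.disjoint_def]
        intro x hx hx'
        obtain ⟨c, d, rfl⟩ := Submodule.mem_span_pair.1 hx
        obtain ⟨rfl, rfl⟩ := hzero c d hx'
        simp
      obtain ⟨M, hMJ, hM, hr⟩ := ih fun x h => φ (v x h)
      have hjM : j ∉ M := fun h => hj (hMJ h)
      have hrank : A.rank = (Φ * A * Φᵀ).rank := by
        rw [← rank_transpose (Φ * A * Φᵀ), transpose_mul, transpose_transpose, transpose_mul,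
          hA, Matrix.neg_mul, Matrix.mul_neg, rank_neg_eq, rank_mul_eq_of_disjoint,
          ← rank_transpose (A * Φᵀ), transpose_mul, transpose_transpose, hA, Matrix.mul_neg,
          rank_neg_eq, rank_mul_eq_of_disjoint Φ A hdisj]
        refine hdisj.mono_right ?_
        rw [mulVecLin_mul]
        exact LinearMap.range_comp_le_range _ _
      have hsum : Φ * A * Φᵀ = ∑ x ∈ J, skew (φ (v x 0)) (φ (v x 1)) := by
        rw [hAdef, Matrix.mul_sum, Matrix.sum_mul]
        refine Finset.sum_congr rfl fun x _ => ?_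
        rw [mul_skew_mul_transpose, ← hΦφ]
        rfl
      refine ⟨insert j M, Finset.insert_subset_insert _ hMJ, ?_, ?_⟩
      · rw [Fintype.linearIndependent_iff] at hM ⊢
        intro g hg
        have hsplit : ∀ f : X → Fin 2 → ι → F,
            ∑ x : (↥(insert j M)) × Fin 2, g x • f x.1 x.2 =
              (g (⟨j, by simp⟩, 0) • f j 0 + g (⟨j, by simp⟩, 1) • f j 1) +
              ∑ x : M × Fin 2, g (⟨x.1, by simp⟩, x.2) • f x.1 x.2 := by
          intro f
          simp only [Fintype.sum_prod_type, Fin.sum_univ_two]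
          rw [← Finset.attach_eq_univ, Finset.attach_insert, Finset.sum_insert,
            Finset.sum_image]
          · rfl
          · intro x _ y _ h
            exact Subtype.ext (by simpa using h)
          · simp [hjM]
        have hker : ∀ h : Fin 2, φ (v j h) = 0 := fun h => by
          rw [← LinearMap.mem_ker, hφ]
          exact Submodule.subset_span (by fin_cases h <;> simp)
        have hφg := congrArg φ hg
        rw [map_sum, map_zero] at hφg
        simp only [map_smul] at hφg
        rw [hsplit (fun x h => φ (v x h)), hker, hker, smul_zero, smul_zero, add_zero,
          zero_add] at hφg
        have hgM := hM (fun x => g (⟨x.1, by simp⟩, x.2)) hφg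
        rw [hsplit v, Finset.sum_eq_zero (s := Finset.univ) (f := fun x : M × Fin 2 =>
          g (⟨x.1, by simp⟩, x.2) • v x.1 x.2) (fun x _ => by rw [hgM x, zero_smul]),
          add_zero] at hg
        obtain ⟨h0, h1⟩ := hzero _ _ (by rw [hg]; exact Submodule.zero_mem _)
        rintro ⟨⟨x, hx⟩, h⟩
        rcases Finset.mem_insert.1 hx with rfl | hx'
        · fin_cases h
          · exact h0
          · exact h1
        · exact hgM (⟨x, hx'⟩, h)
      · rw [Finset.card_insert_of_notMem hjM]
        have h1 := rank_add_le_rank_add_rank A (skew (v j 0) (v j 1))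
        have h2 := rank_skew_le (v j 0) (v j 1)
        rw [hsum] at hrank
        omega

/-- If the pairs `v x` are jointly independent then the sum of their wedge products has full
rank. -/
theorem two_mul_card_le_rank_sum_skew {X : Type*} [Fintype X] (v : X → Fin 2 → ι → F)
    (hv : LinearIndependent F (fun x : X × Fin 2 => v x.1 x.2)) :
    2 * Fintype.card X ≤ (∑ x, skew (v x 0) (v x 1)).rank := by
  classical
  let C : Matrix ι (X × Fin 2) F := Matrix.of fun r x => v x.1 x.2 r
  have hC : Function.Surjective C.vecMul := by
    have hr : Function.Injective C.mulVecLin := Matrix.mulVec_injective_iff.2 hv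
    obtain ⟨g, hg⟩ := C.mulVecLin.exists_leftInverse_of_injective (LinearMap.ker_eq_bot.2 hr)
    refine vecMul_surjective_iff_exists_left_inverse.2 ⟨LinearMap.toMatrix' g, ?_⟩
    apply Matrix.toLin'.injective
    rw [toLin'_mul, toLin'_toMatrix', toLin'_apply', hg, toLin'_one]
  choose f hf using fun y : X × Fin 2 => hC (Pi.single y 1)
  have hdot : ∀ x h y, v x h ⬝ᵥ f y = if (x, h) = y then 1 else 0 := by
    intro x h y
    have := congrFun (hf y) (x, h)
    rw [Pi.single_apply] at this
    rw [dotProduct_comm]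
    exact this
  have hmem : ∀ x : X × Fin 2, v x.1 x.2 ∈
      LinearMap.range (∑ x, skew (v x 0) (v x 1)).mulVecLin := by
    rintro ⟨x, h⟩
    have hA : ∀ y : X × Fin 2, (∑ x, skew (v x 0) (v x 1)) *ᵥ f y =
        ∑ x, ((if (x, 1) = y then (1 : F) else 0) • v x 0 -
          (if (x, 0) = y then (1 : F) else 0) • v x 1) := by
      intro y
      rw [sum_mulVec]
      refine Finset.sum_congr rfl fun x _ => ?_
      simp only [skew, sub_mulVec, vecMulVec_mulVec, hdot]
      simp
    fin_cases h
    · refine ⟨f (x, 1), ?_⟩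
      rw [mulVecLin_apply, hA]
      simp
    · refine ⟨-f (x, 0), ?_⟩
      rw [mulVecLin_apply, mulVec_neg, hA]
      simp
  have := Submodule.finrank_mono (Submodule.span_le.2 (Set.range_subset_iff.2 hmem))
  rw [finrank_span_eq_card hv, Fintype.card_prod, Fintype.card_fin, mul_comm] at this
  exact this

end SkewMatrices

section Specialization

variable {R F L : Type*} [CommRing R] [Field F] [Field L]

/-- Linearly independent vectors have a nonvanishing maximal minor. -/
theorem exists_det_ne_zero {κ ι : Type*} [Fintype κ] [DecidableEq κ] [Fintype ι]
    (v : κ → ι → F) (hv : LinearIndependent F v) :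
    ∃ e : κ → ι, (Matrix.of fun k l => v k (e l)).det ≠ 0 := by
  obtain ⟨κ', e, he, hspan, hli⟩ := exists_linearIndependent' F (fun i k => v k i)
  have : Finite κ' := Finite.of_injective e he
  have := Fintype.ofFinite κ'
  have hcard : Fintype.card κ' = Fintype.card κ := by
    have h1 := finrank_span_eq_card hli
    have h2 : (Matrix.of v).rank = Fintype.card κ := LinearIndependent.rank_matrix hv
    rw [rank_eq_finrank_span_cols] at h2
    rw [← h1, hspan, ← h2]
    rfl
  let σ : κ ≃ κ' := (Fintype.equivOfCardEq hcard).symm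
  refine ⟨e ∘ σ, ?_⟩
  have h := hli.comp σ σ.injective
  have h2 : LinearIndependent F (Matrix.of fun k l => v k ((e ∘ σ) l)).col := h
  exact ((Matrix.isUnit_iff_isUnit_det _).1 (linearIndependent_cols_iff_isUnit.1 h2)).ne_zero

/-- Vectors whose specializations are independent are themselves independent. -/
theorem linearIndependent_of_specialization {κ ι : Type*} [Fintype κ] [Fintype ι]
    (φ : R →+* F) (ψ : R →+* L) (hψ : Function.Injective ψ) (v : κ → ι → R)
    (hv : LinearIndependent F fun k i => φ (v k i)) :
    LinearIndependent L fun k i => ψ (v k i) := by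
  classical
  obtain ⟨e, he⟩ := exists_det_ne_zero _ hv
  have hR : (Matrix.of fun k l => v k (e l)).det ≠ 0 := by
    intro h
    apply he
    have := congrArg φ h
    rwa [RingHom.map_det, map_zero] at this
  have hL : (Matrix.of fun k l => ψ (v k (e l))).det ≠ 0 := by
    have : (Matrix.of fun k l => ψ (v k (e l))) = ψ.mapMatrix (Matrix.of fun k l => v k (e l)) :=
      rfl
    rw [this, ← RingHom.map_det]
    exact (map_ne_zero_iff ψ hψ).2 hR
  have hrow := Matrix.linearIndependent_rows_of_det_ne_zero hL
  exact LinearIndependent.of_comp (LinearMap.funLeft L L e) hrow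

theorem rank_map_le_of_specialization {ι : Type*} [Fintype ι]
    (φ : R →+* F) (ψ : R →+* L) (hψ : Function.Injective ψ) (M : Matrix ι ι R) :
    (M.map φ).rank ≤ (M.map ψ).rank := by
  obtain ⟨κ, e, he, hspan, hli⟩ := exists_linearIndependent' F (M.map φ).col
  have : Finite κ := Finite.of_injective e he
  have := Fintype.ofFinite κ
  have h := linearIndependent_of_specialization φ ψ hψ (fun k i => M i (e k)) hli
  rw [rank_eq_finrank_span_cols, ← hspan, finrank_span_eq_card hli, ← finrank_span_eq_card h,
    rank_eq_finrank_span_cols]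
  refine Submodule.finrank_mono (Submodule.span_mono ?_)
  rintro _ ⟨k, rfl⟩
  exact ⟨e k, rfl⟩

end Specialization

section Transversal

/-- Rado's theorem for vectors: a family of finite sets of vectors satisfying the rank condition
has an independent transversal. -/
theorem exists_independent_transversal {F V X : Type*} [Field F] [AddCommGroup V] [Module F V]
    [FiniteDimensional F V] [Fintype X] (N : ℕ) :
    ∀ A : X → Finset V, ∑ x, (A x).card = N →
      (∀ Y : Finset X, Y.card ≤ Module.finrank F (Submodule.span F {v | ∃ x ∈ Y, v ∈ A x})) →
      ∃ f : X → V, (∀ x, f x ∈ A x) ∧ LinearIndependent F f := by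
  classical
  induction N using Nat.strong_induction_on with
  | _ N ih =>
  intro A hN hA
  have hne : ∀ x, (A x).Nonempty := by
    intro x
    by_contra hx
    rw [Finset.not_nonempty_iff_eq_empty] at hx
    have := hA {x}
    simp [hx] at this
  by_cases hone : ∀ x, (A x).card ≤ 1
  · choose f hf using hne
    refine ⟨f, hf, ?_⟩
    rw [linearIndependent_iff_card_le_finrank_span]
    refine (hA Finset.univ).trans (Submodule.finrank_mono (Submodule.span_mono ?_))
    rintro v ⟨x, -, hv⟩
    exact ⟨x, Finset.card_le_one.1 (hone x) _ (hf x) _ hv⟩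
  · push Not at hone
    obtain ⟨x, hx⟩ := hone
    obtain ⟨p, hp, q, hq, hpq⟩ := Finset.one_lt_card.1 hx
    let B : V → X → Finset V := fun r => Function.update A x ((A x).erase r)
    have hBx : ∀ r, B r x = (A x).erase r := fun r => by simp [B]
    have hBy : ∀ r y, y ≠ x → B r y = A y := fun r y hy => by simp [B, hy]
    have hsub : ∀ r y, B r y ⊆ A y := fun r y => by
      by_cases hy : y = x
      · subst hy; rw [hBx]; exact Finset.erase_subset _ _
      · rw [hBy r y hy]
    have hlt : ∀ r ∈ A x, ∑ y, (B r y).card < N := fun r hr => by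
      rw [← hN]
      refine Finset.sum_lt_sum (fun y _ => Finset.card_le_card (hsub r y)) ⟨x, by simp, ?_⟩
      rw [hBx]
      exact Finset.card_erase_lt_of_mem hr
    have hfinish : ∀ r ∈ A x, (∀ Y : Finset X,
        Y.card ≤ Module.finrank F (Submodule.span F {v | ∃ x ∈ Y, v ∈ B r x})) →
        ∃ f : X → V, (∀ x, f x ∈ A x) ∧ LinearIndependent F f := fun r hr h => by
      obtain ⟨f, hf, hf'⟩ := ih _ (hlt r hr) (B r) rfl h
      exact ⟨f, fun y => hsub r y (hf y), hf'⟩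
    by_contra hcon
    have h1 : ∀ r ∈ A x, ∃ Y : Finset X, x ∉ Y ∧
        Module.finrank F (Submodule.span F
          ({v | ∃ y ∈ Y, v ∈ A y} ∪ ((A x).erase r : Finset V))) ≤ Y.card := by
      intro r hr
      obtain ⟨Y, hY⟩ := not_forall.1 fun h => hcon (hfinish r hr h)
      rw [not_le] at hY
      have hxY : x ∈ Y := by
        by_contra hxY
        refine absurd (hA Y) (not_le.2 ?_)
        have hset : {v | ∃ y ∈ Y, v ∈ A y} = {v | ∃ y ∈ Y, v ∈ B r y} := by
          ext v
          refine exists_congr fun y => and_congr_right fun hy => ?_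
          rw [hBy r y (fun h => hxY (h ▸ hy))]
        rwa [hset]
      refine ⟨Y.erase x, by simp, ?_⟩
      rw [Finset.card_erase_of_mem hxY]
      have hset : {v | ∃ y ∈ Y, v ∈ B r y} =
          {v | ∃ y ∈ Y.erase x, v ∈ A y} ∪ ((A x).erase r : Finset V) := by
        ext v
        constructor
        · rintro ⟨y, hy, hv⟩
          by_cases hyx : y = x
          · subst hyx; rw [hBx] at hv; exact Or.inr hv
          · rw [hBy r y hyx] at hv
            exact Or.inl ⟨y, Finset.mem_erase.2 ⟨hyx, hy⟩, hv⟩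
        · rintro (⟨y, hy, hv⟩ | hv)
          · obtain ⟨hyx, hy⟩ := Finset.mem_erase.1 hy
            exact ⟨y, hy, by rwa [hBy r y hyx]⟩
          · exact ⟨x, hxY, by rw [hBx]; exact hv⟩
      rw [hset] at hY
      omega
    obtain ⟨Y, hxY, hY⟩ := h1 p hp
    obtain ⟨Z, hxZ, hZ⟩ := h1 q hq
    set P := Submodule.span F ({v | ∃ y ∈ Y, v ∈ A y} ∪ ((A x).erase p : Finset V))
    set Q := Submodule.span F ({v | ∃ y ∈ Z, v ∈ A y} ∪ ((A x).erase q : Finset V))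
    have hsup : (insert x (Y ∪ Z)).card ≤ Module.finrank F (P ⊔ Q : Submodule F V) := by
      refine (hA _).trans (Submodule.finrank_mono (Submodule.span_le.2 ?_))
      rintro v ⟨y, hy, hv⟩
      rcases Finset.mem_insert.1 hy with rfl | hy
      · by_cases hvp : v = p
        · refine Submodule.mem_sup_right (Submodule.subset_span (Or.inr ?_))
          exact Finset.mem_erase.2 ⟨by rw [hvp]; exact hpq, hv⟩
        · exact Submodule.mem_sup_left (Submodule.subset_span
            (Or.inr (Finset.mem_erase.2 ⟨hvp, hv⟩)))
      · rcases Finset.mem_union.1 hy with hy | hy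
        · exact Submodule.mem_sup_left (Submodule.subset_span (Or.inl ⟨y, hy, hv⟩))
        · exact Submodule.mem_sup_right (Submodule.subset_span (Or.inl ⟨y, hy, hv⟩))
    have hinf : (Y ∩ Z).card ≤ Module.finrank F (P ⊓ Q : Submodule F V) := by
      refine (hA _).trans (Submodule.finrank_mono (Submodule.span_le.2 ?_))
      rintro v ⟨y, hy, hv⟩
      obtain ⟨hy, hz⟩ := Finset.mem_inter.1 hy
      exact ⟨Submodule.subset_span (Or.inl ⟨y, hy, hv⟩),
        Submodule.subset_span (Or.inl ⟨y, hz, hv⟩)⟩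
    rw [Finset.card_insert_of_notMem (by simp [hxY, hxZ])] at hsup
    have h2 := Submodule.finrank_sup_add_finrank_inf_eq P Q
    have h3 := Finset.card_union_add_card_inter Y Z
    omega

end Transversal

section TightSubspaces

open Module

variable {K V ι : Type*} [Field K] [AddCommGroup V] [Module K V] [Fintype ι]

/-- The weighted number `∑ dim (S ∩ ℓᵢ) zᵢ`. -/
def lineWeight (l : ι → Submodule K V) (z : ι → ℝ) (S : Submodule K V) : ℝ :=
  ∑ i, (finrank K ↥(S ⊓ l i) : ℝ) * z i

/-- A subspace whose constraint holds with equality. -/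
def IsTight (l : ι → Submodule K V) (z : ι → ℝ) (S : Submodule K V) : Prop :=
  lineWeight l z S = finrank K S

theorem lineWeight_bot (l : ι → Submodule K V) (z : ι → ℝ) : lineWeight l z ⊥ = 0 :=
  Finset.sum_eq_zero fun i _ => by rw [bot_inf_eq, finrank_bot, Nat.cast_zero, zero_mul]

theorem isTight_bot (l : ι → Submodule K V) (z : ι → ℝ) : IsTight l z ⊥ := by
  simp [IsTight, lineWeight_bot]

variable [FiniteDimensional K V]

theorem finrank_inf_supermodular (U T l : Submodule K V) :
    finrank K ↥(U ⊓ l) + finrank K ↥(T ⊓ l) ≤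
      finrank K ↥((U ⊔ T) ⊓ l) + finrank K ↥(U ⊓ T ⊓ l) := by
  rw [← Submodule.finrank_sup_add_finrank_inf_eq (U ⊓ l) (T ⊓ l), ← inf_inf_distrib_right]
  refine Nat.add_le_add_right (Submodule.finrank_mono ?_) _
  exact sup_le (inf_le_inf_right _ le_sup_left) (inf_le_inf_right _ le_sup_right)

theorem lineWeight_add_le (l : ι → Submodule K V) (z : ι → ℝ) (hz : ∀ i, 0 ≤ z i)
    (U T : Submodule K V) : lineWeight l z U + lineWeight l z T ≤
      lineWeight l z (U ⊔ T) + lineWeight l z (U ⊓ T) := by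
  simp only [lineWeight, ← Finset.sum_add_distrib, ← add_mul]
  refine Finset.sum_le_sum fun i _ => mul_le_mul_of_nonneg_right ?_ (hz i)
  exact_mod_cast finrank_inf_supermodular U T (l i)

theorem IsTight.sup_inf {l : ι → Submodule K V} {z : ι → ℝ} (hz : ∀ i, 0 ≤ z i)
    (hP : ∀ S, lineWeight l z S ≤ finrank K S) {U T : Submodule K V}
    (hU : IsTight l z U) (hT : IsTight l z T) :
    IsTight l z (U ⊔ T) ∧ IsTight l z (U ⊓ T) ∧ ∀ w : ι → ℝ, (∀ i, z i = 0 → w i = 0) →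
      lineWeight l w (U ⊔ T) + lineWeight l w (U ⊓ T) =
        lineWeight l w U + lineWeight l w T := by
  have h1 := lineWeight_add_le l z hz U T
  have h2 : (finrank K ↥(U ⊔ T) : ℝ) + finrank K ↥(U ⊓ T) = finrank K U + finrank K T := by
    exact_mod_cast Submodule.finrank_sup_add_finrank_inf_eq U T
  have h3 := hP (U ⊔ T)
  have h4 := hP (U ⊓ T)
  unfold IsTight at *
  refine ⟨by linarith, by linarith, fun w hw => ?_⟩
  have h5 : lineWeight l z U + lineWeight l z T =
      lineWeight l z (U ⊔ T) + lineWeight l z (U ⊓ T) := by linarith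
  simp only [lineWeight, ← Finset.sum_add_distrib, ← add_mul] at h5 ⊢
  rw [Finset.sum_eq_sum_iff_of_le] at h5
  · refine Finset.sum_congr rfl fun i hi => ?_
    by_cases hzi : z i = 0
    · simp [hw i hzi]
    · rw [mul_right_cancel₀ hzi (h5 i hi)]
  · intro i _
    refine mul_le_mul_of_nonneg_right ?_ (hz i)
    exact_mod_cast finrank_inf_supermodular U T (l i)

/-- A maximal chain in a family of subspaces containing `⊥`, followed by `⊤`. -/
theorem exists_maximal_chain (P : Submodule K V → Prop) (hbot : P ⊥) :
    ∃ S : ℕ → Submodule K V, S 0 = ⊥ ∧ Monotone S ∧ (∃ N, S N = ⊤) ∧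
      (∀ k, P (S k) ∨ S k = ⊤) ∧
      ∀ k T, P T → S k ≤ T → T ≤ S (k + 1) → T = S k ∨ T = S (k + 1) := by
  classical
  have step : ∀ U : Submodule K V, ∃ U' : Submodule K V, U ≤ U' ∧ (U ≠ ⊤ → U < U') ∧
      (P U' ∨ U' = ⊤) ∧ ∀ T, P T → U ≤ T → T ≤ U' → T = U ∨ T = U' := by
    intro U
    by_cases h : ∃ T, P T ∧ U < T
    · obtain ⟨M, ⟨hM, hUM⟩, hmin⟩ := WellFounded.has_min
        (wellFounded_lt (α := Submodule K V)) {T | P T ∧ U < T} h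
      refine ⟨M, hUM.le, fun _ => hUM, Or.inl hM, fun T hT hUT hTM => ?_⟩
      rcases hUT.eq_or_lt with h | h
      · exact Or.inl h.symm
      · exact Or.inr (hTM.eq_of_not_lt (hmin T ⟨hT, h⟩))
    · refine ⟨⊤, le_top, fun hU => lt_top_iff_ne_top.2 hU, Or.inr rfl, fun T hT hUT _ => ?_⟩
      rcases hUT.eq_or_lt with h' | h'
      · exact Or.inl h'.symm
      · exact absurd ⟨T, hT, h'⟩ h
  choose next hle hlt hP hcov using step
  let S : ℕ → Submodule K V := fun k => next^[k] ⊥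
  have hS : ∀ k, S (k + 1) = next (S k) := fun k => Function.iterate_succ_apply' _ _ _
  refine ⟨S, rfl, monotone_nat_of_le_succ fun k => by rw [hS]; exact hle _, ?_, ?_, ?_⟩
  · by_contra hne
    push Not at hne
    have hgrow : ∀ k, k ≤ finrank K (S k) := by
      intro k
      induction k with
      | zero => simp
      | succ k ih =>
        have := Submodule.finrank_lt_finrank_of_lt (hlt _ (hne k))
        rw [← hS] at this
        omega
    have := (hgrow (finrank K V + 1)).trans (Submodule.finrank_le _)
    omega
  · intro k
    cases k with
    | zero => exact Or.inl hbot
    | succ k => rw [hS]; exact hP _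
  · intro k
    rw [hS]
    exact hcov _

/-- A weight vanishing on a maximal chain of tight subspaces vanishes on every tight subspace. -/
theorem lineWeight_eq_zero_of_chain {l : ι → Submodule K V} {z : ι → ℝ} (hz : ∀ i, 0 ≤ z i)
    (hP : ∀ S, lineWeight l z S ≤ finrank K S) {S : ℕ → Submodule K V} (h0 : S 0 = ⊥)
    (hmono : Monotone S) {N : ℕ} (hN : S N = ⊤) (hS : ∀ k, IsTight l z (S k) ∨ S k = ⊤)
    (hcov : ∀ k T, IsTight l z T → S k ≤ T → T ≤ S (k + 1) → T = S k ∨ T = S (k + 1))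
    (w : ι → ℝ) (hw : ∀ i, z i = 0 → w i = 0)
    (hwS : ∀ k, IsTight l z (S k) → lineWeight l w (S k) = 0) (T : Submodule K V)
    (hT : IsTight l z T) : lineWeight l w T = 0 := by
  have key : ∀ k, lineWeight l w (T ⊓ S k) = 0 := by
    intro k
    induction k with
    | zero => rw [h0, inf_bot_eq, lineWeight_bot]
    | succ k ih =>
      rcases hS k with hk | hk
      · have hle := hmono (Nat.le_succ k)
        have hU : IsTight l z (T ⊓ S (k + 1)) := by
          rcases hS (k + 1) with h | h
          · exact (hT.sup_inf hz hP h).2.1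
          · rwa [h, inf_top_eq]
        obtain ⟨hsup, -, hmod⟩ := hU.sup_inf hz hP hk
        have hmod := hmod w hw
        rw [inf_assoc, inf_eq_right.2 hle, ih, hwS k hk] at hmod
        have hsup0 : lineWeight l w (T ⊓ S (k + 1) ⊔ S k) = 0 := by
          rcases hcov k _ hsup le_sup_right (sup_le inf_le_right hle) with h | h
          · rw [h, hwS k hk]
          · rw [h] at hsup ⊢
            exact hwS _ hsup
        linarith
      · rwa [top_unique (hk ▸ hmono (Nat.le_succ k) : ⊤ ≤ S (k + 1)), ← hk]
  have := key N
  rwa [hN, inf_top_eq] at this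

/-- The constraints that are tight at an extreme point determine it. -/
theorem eq_zero_of_extreme {l : ι → Submodule K V} {z : ι → ℝ}
    (hz : z ∈ Set.extremePoints ℝ {z : ι → ℝ | (∀ i, 0 ≤ z i) ∧
      ∀ S, lineWeight l z S ≤ finrank K S})
    (w : ι → ℝ) (hw : ∀ i, z i = 0 → w i = 0)
    (hwT : ∀ T, IsTight l z T → lineWeight l w T = 0) : w = 0 := by
  have hlin : ∀ (c : ℝ) S, lineWeight l (z + c • w) S = lineWeight l z S + c * lineWeight l w S := by
    intro c S
    simp only [lineWeight, Pi.add_apply, Pi.smul_apply, smul_eq_mul, Finset.mul_sum,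
      ← Finset.sum_add_distrib]
    exact Finset.sum_congr rfl fun i _ => by ring
  obtain ⟨⟨hz0, hzP⟩, hext⟩ := hz
  have hfin : Set.Finite (Set.range fun S : Submodule K V =>
      ((fun i => finrank K ↥(S ⊓ l i), finrank K S) : (ι → ℕ) × ℕ)) := by
    refine Set.Finite.subset (Set.Finite.prod
      (Set.Finite.pi (fun _ : ι => Set.finite_Iic (finrank K V)))
      (Set.finite_Iic (finrank K V))) ?_
    rintro _ ⟨S, rfl⟩
    exact ⟨fun i _ => Submodule.finrank_le _, Submodule.finrank_le _⟩
  have hfin' : Set.Finite (Set.range fun S : Submodule K V =>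
      ((finrank K S : ℝ) - lineWeight l z S, |lineWeight l w S|)) := by
    refine (hfin.image fun x => ((x.2 : ℝ) - ∑ i, (x.1 i : ℝ) * z i,
      |∑ i, (x.1 i : ℝ) * w i|)).subset ?_
    rintro _ ⟨S, rfl⟩
    exact ⟨_, ⟨S, rfl⟩, rfl⟩
  have hev : ∀ᶠ c : ℝ in nhdsWithin 0 (Set.Ioi 0),
      (∀ p ∈ Set.range fun S : Submodule K V =>
        ((finrank K S : ℝ) - lineWeight l z S, |lineWeight l w S|), 0 < p.1 → c * p.2 < p.1) ∧
      ∀ i, 0 < z i → c * |w i| < z i := by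
    refine Filter.Eventually.and ?_ ?_
    · refine (Filter.eventually_all_finite hfin').2 fun p _ => ?_
      by_cases hp : 0 < p.1
      · have : Filter.Tendsto (fun c : ℝ => c * p.2) (nhdsWithin 0 (Set.Ioi 0)) (nhds (0 * p.2)) :=
          (Filter.tendsto_id.mono_left nhdsWithin_le_nhds).mul_const _
        rw [zero_mul] at this
        filter_upwards [this.eventually_lt_const hp] with c hc _ using hc
      · exact Filter.Eventually.of_forall fun c h => absurd h hp
    · refine Filter.eventually_all.2 fun i => ?_
      by_cases hp : 0 < z i
      · have : Filter.Tendsto (fun c : ℝ => c * |w i|) (nhdsWithin 0 (Set.Ioi 0))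
            (nhds (0 * |w i|)) := (Filter.tendsto_id.mono_left nhdsWithin_le_nhds).mul_const _
        rw [zero_mul] at this
        filter_upwards [this.eventually_lt_const hp] with c hc _ using hc
      · exact Filter.Eventually.of_forall fun c h => absurd h hp
  obtain ⟨c, ⟨hc1, hc2⟩, hc⟩ := (hev.and self_mem_nhdsWithin).exists
  have hc : 0 < c := hc
  have hmem : ∀ d : ℝ, |d| = c → z + d • w ∈ {z : ι → ℝ | (∀ i, 0 ≤ z i) ∧
      ∀ S, lineWeight l z S ≤ finrank K S} := by
    intro d hd
    refine ⟨fun i => ?_, fun S => ?_⟩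
    · rcases (hz0 i).eq_or_lt with h | h
      · simp [hw i h.symm, ← h]
      · have h1 := hc2 i h
        rw [← hd, ← abs_mul] at h1
        have := (abs_lt.1 h1).1
        simp only [Pi.add_apply, Pi.smul_apply, smul_eq_mul]
        linarith
    · rw [hlin]
      rcases (hzP S).eq_or_lt with h | h
      · rw [hwT S h, mul_zero, add_zero, h]
      · have h1 := hc1 _ ⟨S, rfl⟩ (by simpa using h)
        simp only at h1
        rw [← hd, ← abs_mul] at h1
        have := (abs_lt.1 h1).2
        linarith
  have h1 := hmem c (abs_of_pos hc)
  have h2 := hmem (-c) (by rw [abs_neg, abs_of_pos hc])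
  have h3 : z ∈ openSegment ℝ (z + c • w) (z + (-c) • w) := by
    refine ⟨1 / 2, 1 / 2, by norm_num, by norm_num, by norm_num, ?_⟩
    ext i
    simp
    ring
  have h4 := hext h1 h2 h3
  have h5 : c • w = 0 := by simpa using h4
  exact (smul_eq_zero.1 h5).resolve_left hc.ne'

end TightSubspaces

section HalfIntegrality

/-- A vector determined by integral equations whose coefficient matrix has column sums at most two
is half-integral. Each index `i` contributes to the equations numbered `L (i, 0)`, `L (i, 1)`. -/
theorem half_integral_of_determined {ι : Type*} [Fintype ι] (z : ι → ℝ) (L : ι × Fin 2 → ℕ)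
    (P : ℕ → Prop)
    (hz_int : ∀ k, P k → ∃ d : ℤ, ∑ x with L x = k, z x.1 = d)
    (hinj : ∀ w : ι → ℝ, (∀ i, z i = 0 → w i = 0) →
      (∀ k, P k → ∑ x with L x = k, w x.1 = 0) → w = 0) (i : ι) :
    ∃ s : ℤ, z i = s / 2 := by
  classical
  let I : Finset ι := {i | Int.fract (z i) ≠ 0}
  let E : Finset (ι × Fin 2) := {x | x.1 ∈ I ∧ P (L x)}
  have hI : ∀ j, j ∈ I ↔ Int.fract (z j) ≠ 0 := fun j => by simp [I]
  have hE : ∀ x, x ∈ E ↔ x.1 ∈ I ∧ P (L x) := fun x => by simp [E]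
  have hrow : ∀ (w : ι → ℝ), (∀ j, j ∉ I → w j = 0) → ∀ k, P k →
      ∑ x with L x = k, w x.1 = ∑ x ∈ E with L x = k, w x.1 := by
    intro w hw k hk
    refine (Finset.sum_subset (Finset.filter_subset_filter _ (Finset.subset_univ _)) ?_).symm
    intro x hx hx'
    refine hw _ fun hxI => hx' ?_
    simp only [Finset.mem_filter, Finset.mem_univ, true_and] at hx ⊢
    exact ⟨(hE x).2 ⟨hxI, hx ▸ hk⟩, hx⟩
  have hintE : ∀ k, P k → ∃ d : ℤ, ∑ x ∈ E with L x = k, z x.1 = d := by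
    intro k hk
    obtain ⟨d, hd⟩ := hz_int k hk
    refine ⟨d - ∑ x with L x = k, if x.1 ∈ I then 0 else ⌊z x.1⌋, ?_⟩
    have hsum : ∑ x ∈ E with L x = k, z x.1 =
        ∑ x ∈ E with L x = k, if x.1 ∈ I then z x.1 else 0 :=
      Finset.sum_congr rfl fun x hx => (if_pos ((hE x).1 (Finset.mem_filter.1 hx).1).1).symm
    rw [hsum, ← hrow (fun j => if j ∈ I then z j else 0) (fun j hj => if_neg hj) k hk]
    push_cast
    rw [← hd, ← Finset.sum_sub_distrib]
    refine Finset.sum_congr rfl fun x _ => ?_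
    by_cases hx : x.1 ∈ I
    · simp [hx]
    · have h0 : Int.fract (z x.1) = 0 := by_contra fun h => hx ((hI _).2 h)
      have := Int.floor_add_fract (z x.1)
      simp only [hx, if_false]
      linarith
  have hPE : ∀ k ∈ E.image L, P k := by
    intro k hk
    obtain ⟨x, hx, rfl⟩ := Finset.mem_image.1 hk
    exact ((hE x).1 hx).2
  have hcard1 : I.card ≤ (E.image L).card := by
    let ext : (I → ℝ) →ₗ[ℝ] (ι → ℝ) :=
      { toFun := fun g j => if h : j ∈ I then g ⟨j, h⟩ else 0
        map_add' := fun g g' => by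
          ext j
          by_cases h : j ∈ I <;> simp [h]
        map_smul' := fun c g => by
          ext j
          by_cases h : j ∈ I <;> simp [h] }
    let f : (I → ℝ) →ₗ[ℝ] (E.image L → ℝ) :=
      LinearMap.pi fun k => ∑ x with L x = k, LinearMap.proj x.1 ∘ₗ ext
    have hf : Function.Injective f := by
      rw [← LinearMap.ker_eq_bot, LinearMap.ker_eq_bot']
      intro g hg
      have hext : ∀ j, j ∉ I → ext g j = 0 := fun j hj => dif_neg hj
      have h0 : ext g = 0 := by
        refine hinj _ (fun j hj => hext j fun h => (hI j).1 h (by rw [hj, Int.fract_zero])) ?_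
        intro k hk
        by_cases hkE : k ∈ E.image L
        · have := congrFun hg ⟨k, hkE⟩
          simpa [f] using this
        · rw [hrow _ hext k hk]
          refine Finset.sum_eq_zero fun x hx => absurd ?_ hkE
          have hx' := Finset.mem_filter.1 hx
          exact hx'.2 ▸ Finset.mem_image_of_mem L hx'.1
      ext ⟨j, hj⟩
      have := congrFun h0 j
      simpa [ext, hj] using this
    simpa using LinearMap.finrank_le_finrank_of_injective hf
  have hcard2 : ∀ k ∈ E.image L, 2 ≤ (E.filter (L · = k)).card := by
    intro k hk
    obtain ⟨d, hd⟩ := hintE k (hPE k hk)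
    obtain ⟨x, hx, hxk⟩ := Finset.mem_image.1 hk
    have hmem : x ∈ E.filter (L · = k) := Finset.mem_filter.2 ⟨hx, hxk⟩
    by_contra hlt
    have hone : (E.filter (L · = k)).card = 1 := by
      have := Finset.card_pos.2 ⟨x, hmem⟩
      omega
    obtain ⟨y, hy⟩ := Finset.card_eq_one.1 hone
    rw [hy, Finset.mem_singleton] at hmem
    rw [hy, Finset.sum_singleton, ← hmem] at hd
    exact (hI _).1 ((hE x).1 hx).1 (by rw [hd, Int.fract_intCast])
  have hcard3 : E.card ≤ 2 * I.card := by
    have : E ⊆ I ×ˢ (Finset.univ : Finset (Fin 2)) := fun x hx => by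
      simpa using ((hE x).1 hx).1
    have := Finset.card_le_card this
    rw [Finset.card_product, Finset.card_univ, Fintype.card_fin] at this
    omega
  have hcard4 : ∀ k ∈ E.image L, (E.filter (L · = k)).card = 2 := by
    have hsum := Finset.card_eq_sum_card_image L E
    have h2 : ∑ k ∈ E.image L, 2 = ∑ k ∈ E.image L, (E.filter (L · = k)).card := by
      refine le_antisymm (Finset.sum_le_sum hcard2) ?_
      rw [← hsum, Finset.sum_const, smul_eq_mul]
      omega
    intro k hk
    exact ((Finset.sum_eq_sum_iff_of_le hcard2).1 h2 k hk).symm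
  let w : ι → ℝ := fun j => if j ∈ I then Int.fract (z j) - 1 / 2 else 0
  have hw : w = 0 := by
    refine hinj w (fun j hj => if_neg fun h => (hI j).1 h (by rw [hj, Int.fract_zero])) ?_
    intro k hk
    rw [hrow w (fun j hj => if_neg hj) k hk]
    by_cases hkE : k ∈ E.image L
    · obtain ⟨x, y, hxy, hset⟩ := Finset.card_eq_two.1 (hcard4 k hkE)
      obtain ⟨d, hd⟩ := hintE k hk
      have hx : x.1 ∈ I := ((hE x).1 (Finset.mem_filter.1
        (hset ▸ Finset.mem_insert_self x {y} : x ∈ E.filter (L · = k))).1).1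
      have hy : y.1 ∈ I := ((hE y).1 (Finset.mem_filter.1
        (hset ▸ Finset.mem_insert_of_mem (Finset.mem_singleton_self y) :
          y ∈ E.filter (L · = k))).1).1
      rw [hset, Finset.sum_pair hxy] at hd ⊢
      simp only [w, hx, hy, if_true]
      have hx0 : 0 < Int.fract (z x.1) := lt_of_le_of_ne (Int.fract_nonneg _) ((hI _).1 hx).symm
      have hy0 : 0 < Int.fract (z y.1) := lt_of_le_of_ne (Int.fract_nonneg _) ((hI _).1 hy).symm
      have hx1 := Int.fract_lt_one (z x.1)
      have hy1 := Int.fract_lt_one (z y.1)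
      have hsum : Int.fract (z x.1) + Int.fract (z y.1) =
          ((d - ⌊z x.1⌋ - ⌊z y.1⌋ : ℤ) : ℝ) := by
        push_cast
        rw [← hd, Int.fract, Int.fract]
        ring
      have h1 : (0 : ℤ) < d - ⌊z x.1⌋ - ⌊z y.1⌋ := by
        have : (0 : ℝ) < ((d - ⌊z x.1⌋ - ⌊z y.1⌋ : ℤ) : ℝ) := by linarith
        exact_mod_cast this
      have h2 : d - ⌊z x.1⌋ - ⌊z y.1⌋ < 2 := by
        have : ((d - ⌊z x.1⌋ - ⌊z y.1⌋ : ℤ) : ℝ) < 2 := by linarith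
        exact_mod_cast this
      have h3 : d - ⌊z x.1⌋ - ⌊z y.1⌋ = 1 := by omega
      rw [h3] at hsum
      push_cast at hsum
      linarith
    · refine Finset.sum_eq_zero fun x hx => absurd ?_ hkE
      have hx' := Finset.mem_filter.1 hx
      exact hx'.2 ▸ Finset.mem_image_of_mem L hx'.1
  have hfloor := Int.floor_add_fract (z i)
  by_cases hi : i ∈ I
  · have h := congrFun hw i
    simp only [w, hi, if_true, Pi.zero_apply] at h
    refine ⟨2 * ⌊z i⌋ + 1, ?_⟩
    push_cast
    linarith
  · have h0 : Int.fract (z i) = 0 := by_contra fun h => hi ((hI _).2 h)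
    refine ⟨2 * ⌊z i⌋, ?_⟩
    push_cast
    linarith

end HalfIntegrality

section AdaptedBases

open Module

variable {K V : Type*} [Field K] [AddCommGroup V] [Module K V]

theorem exists_level (S : ℕ → Submodule K V) (h0 : S 0 = ⊥) (hmono : Monotone S) {N : ℕ}
    (hN : S N = ⊤) (v : V) (hv : v ≠ 0) : ∃ L : ℕ, ∀ k, v ∈ S k ↔ L < k := by
  classical
  have hex : ∃ k, v ∈ S k := ⟨N, hN ▸ Submodule.mem_top⟩
  have hpos : Nat.find hex ≠ 0 := by
    intro h
    have := Nat.find_spec hex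
    rw [h, h0] at this
    exact hv this
  refine ⟨Nat.find hex - 1, fun k => ?_⟩
  have : v ∈ S k ↔ Nat.find hex ≤ k :=
    ⟨fun h => Nat.find_min' hex h, fun h => hmono h (Nat.find_spec hex)⟩
  rw [this]
  omega

variable [FiniteDimensional K V]

/-- A line in a filtered space has a basis, obtained by a unimodular change of basis, that is
adapted to the filtration. -/
theorem exists_adapted_basis (p q : V) (hpq : LinearIndependent K ![p, q])
    (S : ℕ → Submodule K V) (hmono : Monotone S) {N : ℕ} (hN : S N = ⊤) :
    ∃ (v : Fin 2 → V) (c d c' d' : K), v 0 = c • p + d • q ∧ v 1 = c' • p + d' • q ∧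
      c * d' - d * c' = 1 ∧ LinearIndependent K v ∧
      Submodule.span K (Set.range v) = Submodule.span K {p, q} ∧
      ∀ k, finrank K ↥(S k ⊓ Submodule.span K {p, q}) =
        Nat.card {h : Fin 2 // v h ∈ S k} := by
  classical
  set l := Submodule.span K {p, q} with hl
  have hrange : Set.range ![p, q] = {p, q} := by simp [Set.pair_comm]
  have hfl : finrank K l = 2 := by
    have := finrank_span_eq_card hpq
    rwa [hrange, Fintype.card_fin] at this
  have hex : ∃ k, S k ⊓ l ≠ ⊥ := ⟨N, by
    rw [hN, top_inf_eq]
    intro h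
    rw [h, finrank_bot] at hfl
    omega⟩
  obtain ⟨x, hx, hx0⟩ := Submodule.exists_mem_ne_zero_of_ne_bot (Nat.find_spec hex)
  obtain ⟨c, d, hcd⟩ := Submodule.mem_span_pair.1 hx.2
  obtain ⟨c', d', hdet⟩ : ∃ c' d' : K, c * d' - d * c' = 1 := by
    by_cases hc : c = 0
    · have hd : d ≠ 0 := by
        rintro rfl
        apply hx0
        rw [← hcd, hc]
        simp
      exact ⟨-d⁻¹, 0, by simp [hd]⟩
    · exact ⟨0, c⁻¹, by simp [hc]⟩
  let v : Fin 2 → V := ![x, c' • p + d' • q]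
  have hp : p = d' • x - d • (c' • p + d' • q) := by
    have h : p = (c * d' - d * c') • p := by rw [hdet, one_smul]
    calc p = (c * d' - d * c') • p := h
      _ = _ := by rw [← hcd]; module
  have hq : q = c • (c' • p + d' • q) - c' • x := by
    have h : q = (c * d' - d * c') • q := by rw [hdet, one_smul]
    calc q = (c * d' - d * c') • q := h
      _ = _ := by rw [← hcd]; module
  have hspan : Submodule.span K (Set.range v) = l := by
    have hv : Set.range v = {x, c' • p + d' • q} := by simp [v, Set.pair_comm]
    rw [hv]
    apply le_antisymm
    · rw [Submodule.span_le, Set.pair_subset_iff]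
      exact ⟨hx.2, Submodule.mem_span_pair.2 ⟨_, _, rfl⟩⟩
    · rw [hl, Submodule.span_le, Set.pair_subset_iff]
      exact ⟨Submodule.mem_span_pair.2 ⟨d', -d, by rw [neg_smul, ← sub_eq_add_neg, ← hp]⟩,
        Submodule.mem_span_pair.2 ⟨-c', c, by rw [neg_smul, neg_add_eq_sub, ← hq]⟩⟩
  have hli : LinearIndependent K v := by
    rw [linearIndependent_iff_card_eq_finrank_span, Set.finrank, hspan, hfl, Fintype.card_fin]
  refine ⟨v, c, d, c', d', hcd.symm, rfl, hdet, hli, hspan, fun k => ?_⟩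
  have hvl : ∀ h, v h ∈ l := fun h => hspan ▸ Submodule.subset_span ⟨h, rfl⟩
  rw [Nat.card_eq_fintype_card, Fintype.card_subtype]
  rcases lt_or_ge k (Nat.find hex) with hk | hk
  · have hbot : S k ⊓ l = ⊥ := not_not.1 (Nat.find_min hex hk)
    rw [hbot, finrank_bot, eq_comm, Finset.card_eq_zero, Finset.filter_eq_empty_iff]
    intro h _ hmem
    have : v h ∈ S k ⊓ l := ⟨hmem, hvl h⟩
    rw [hbot] at this
    exact hli.ne_zero h this
  · have hxk : v 0 ∈ S k := hmono hk hx.1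
    by_cases h1 : v 1 ∈ S k
    · have hle : l ≤ S k := by
        rw [← hspan, Submodule.span_le]
        rintro _ ⟨h, rfl⟩
        fin_cases h
        exacts [hxk, h1]
      rw [inf_eq_right.2 hle, hfl, Finset.filter_true_of_mem]
      · simp
      · intro h _
        fin_cases h
        exacts [hxk, h1]
    · have hlt : S k ⊓ l < l := lt_of_le_of_ne inf_le_right fun h =>
        h1 ((h.symm ▸ hvl 1 : v 1 ∈ S k ⊓ l).1)
      have hlt := Submodule.finrank_lt_finrank_of_lt hlt
      have hpos : 0 < finrank K ↥(S k ⊓ l) := by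
        rw [Nat.pos_iff_ne_zero, Ne, Submodule.finrank_eq_zero]
        intro h
        have hm : v 0 ∈ S k ⊓ l := ⟨hxk, hvl 0⟩
        rw [h] at hm
        exact hli.ne_zero 0 hm
      have hfilter : (Finset.univ.filter fun h => v h ∈ S k) = {0} := by
        ext h
        fin_cases h
        · simpa using hxk
        · simpa using h1
      rw [hfilter, Finset.card_singleton]
      omega

end AdaptedBases

section TensorFamilies

open Module

variable {F ι : Type*} [Field F]

/-- The Kronecker product of a vector of length two and a vector. -/
def tens (u : Fin 2 → F) (v : ι → F) : Fin 2 × ι → F := fun x => u x.1 * v x.2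

/-- The linear map `v ↦ e_q ⊗ v`. -/
def tensSingle (F ι : Type*) [Field F] (q : Fin 2) : (ι → F) →ₗ[F] (Fin 2 × ι → F) where
  toFun v := tens (Pi.single q 1) v
  map_add' v w := by ext; simp [tens, mul_add]
  map_smul' c v := by ext; simp [tens, mul_left_comm]

theorem tensSingle_apply (q : Fin 2) (v : ι → F) :
    tensSingle F ι q v = tens (Pi.single q 1) v := rfl

theorem tensSingle_apply_same (q : Fin 2) (v : ι → F) (r : ι) : tensSingle F ι q v (q, r) = v r := by
  simp [tensSingle_apply, tens]

theorem tensSingle_apply_of_ne {q q' : Fin 2} (h : q' ≠ q) (v : ι → F) (r : ι) :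
    tensSingle F ι q v (q', r) = 0 := by
  simp [tensSingle_apply, tens, h]

theorem tensSingle_injective (q : Fin 2) : Function.Injective (tensSingle F ι q) := by
  intro v w h
  ext r
  rw [← tensSingle_apply_same q v, h, tensSingle_apply_same]

theorem tens_eq_add (u : Fin 2 → F) (v : ι → F) :
    tens u v = u 0 • tensSingle F ι 0 v + u 1 • tensSingle F ι 1 v := by
  ext ⟨q, r⟩
  fin_cases q <;> simp [tensSingle_apply, tens]

theorem finrank_tensSingle_sup [Fintype ι] (U : Fin 2 → Submodule F (ι → F)) :
    finrank F ↥((U 0).map (tensSingle F ι 0) ⊔ (U 1).map (tensSingle F ι 1)) =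
      finrank F (U 0) + finrank F (U 1) := by
  have hinf : (U 0).map (tensSingle F ι 0) ⊓ (U 1).map (tensSingle F ι 1) = ⊥ := by
    rw [eq_bot_iff]
    rintro _ ⟨⟨v, -, rfl⟩, ⟨w, -, hw⟩⟩
    have : v = 0 := by
      ext r
      rw [← tensSingle_apply_same 0 v, ← hw, tensSingle_apply_of_ne zero_ne_one, Pi.zero_apply]
    simp [this]
  have h := Submodule.finrank_sup_add_finrank_inf_eq
    ((U 0).map (tensSingle F ι 0)) ((U 1).map (tensSingle F ι 1))
  rw [hinf, finrank_bot, add_zero] at h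
  rw [h, (Submodule.equivMapOfInjective _ (tensSingle_injective 0) (U 0)).finrank_eq,
    (Submodule.equivMapOfInjective _ (tensSingle_injective 1) (U 1)).finrank_eq]

/-- If a weighted family of lines satisfies the matching constraints and all but one of the lines
contribute at most one vector, then suitable tensor products are independent. -/
theorem exists_independent_tens {X : Type*} [Fintype X] [Fintype ι] (Q : X → Submodule F (ι → F))
    (s : X → ℕ) (hQ : ∀ S, ∑ i, finrank F ↥(S ⊓ Q i) * s i ≤ 2 * finrank F S)
    (x : X → Fin 2 → ι → F) (E : X → Set (Fin 2)) (hxQ : ∀ i, ∀ h ∈ E i, x i h ∈ Q i)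
    (hx : ∀ i, LinearIndepOn F (x i) (E i)) (i₀ : X)
    (hE : ∀ i ≠ i₀, (E i).Subsingleton) :
    ∃ u : X → Fin 2 → Fin 2 → F,
      LinearIndependent F fun y : {y : X × Fin 2 × Fin 2 // (y.2.1 : ℕ) < s y.1 ∧ y.2.2 ∈ E y.1} =>
        tens (u y.1.1 y.1.2.1) (x y.1.1 y.1.2.2) := by
  classical
  let I := {y : X × Fin 2 × Fin 2 // (y.2.1 : ℕ) < s y.1 ∧ y.2.2 ∈ E y.1}
  let vec : I → ι → F := fun y => x y.1.1 y.1.2.2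
  let A : I → Finset (Fin 2 × ι → F) := fun y =>
    if y.1.1 = i₀ then {tensSingle F ι y.1.2.1 (vec y)}
    else {tensSingle F ι 0 (vec y), tensSingle F ι 1 (vec y)}
  have hlow : ∀ r : ℕ, (Finset.univ.filter fun c : Fin 2 => (c : ℕ) < r).card ≤ r := by
    intro r
    have := Finset.card_le_card_of_injOn (s := Finset.univ.filter fun c : Fin 2 => (c : ℕ) < r)
      (t := Finset.range r) (fun c => (c : ℕ)) (fun c hc => by simpa using hc)
      (fun c _ d _ h => Fin.ext h)
    rwa [Finset.card_range] at this
  obtain ⟨f, hfA, hf⟩ := exists_independent_transversal (F := F) _ A rfl (by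
    intro Y
    let S : Submodule F (ι → F) := Submodule.span F {v | ∃ y ∈ Y, y.1.1 ≠ i₀ ∧ vec y = v}
    let H : Fin 2 → Finset (Fin 2) := fun c =>
      Finset.univ.filter fun h => ∃ y ∈ Y, y.1 = (i₀, c, h)
    let G : Fin 2 → Submodule F (ι → F) := fun c => Submodule.span F (x i₀ '' H c)
    have hHE : ∀ c, ∀ h ∈ H c, (c : ℕ) < s i₀ ∧ h ∈ E i₀ := by
      intro c h hh
      obtain ⟨y, -, hy⟩ := (Finset.mem_filter.1 hh).2
      simpa [hy] using y.2
    have hG : ∀ c, finrank F (G c) = (H c).card := by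
      intro c
      have hli : LinearIndepOn F (x i₀) (H c : Set (Fin 2)) :=
        (hx i₀).mono fun h hh => (hHE c h hh).2
      have := finrank_span_eq_card hli
      rw [← Set.image_eq_range] at this
      simpa using this
    have hY0 : (Y.filter fun y => y.1.1 = i₀).card ≤ (H 0).card + (H 1).card := by
      have := Finset.card_le_card_of_injOn (s := Y.filter fun y => y.1.1 = i₀)
        (t := Finset.univ.sigma H) (fun y => ⟨y.1.2.1, y.1.2.2⟩)
        (fun y hy => by
          obtain ⟨hy, hy'⟩ := Finset.mem_filter.1 hy
          simp only [Finset.coe_sigma, Set.mem_sigma_iff, Finset.mem_coe, Finset.mem_univ,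
            true_and, H, Finset.mem_filter]
          exact ⟨y, hy, by rw [← hy']⟩)
        (fun y hy z hz hyz => by
          have hy' := (Finset.mem_filter.1 hy).2
          have hz' := (Finset.mem_filter.1 hz).2
          simp only [Sigma.mk.injEq, heq_eq_eq] at hyz
          exact Subtype.ext (Prod.ext (hy'.trans hz'.symm) (Prod.ext hyz.1 hyz.2)))
      rwa [Finset.card_sigma, Fin.sum_univ_two] at this
    have hY1 : (Y.filter fun y => ¬ y.1.1 = i₀).card ≤
        ∑ i ∈ Finset.univ.erase i₀, finrank F ↥(S ⊓ Q i) * s i := by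
      rw [Finset.card_eq_sum_card_fiberwise (f := fun y : I => y.1.1)
        (t := Finset.univ.erase i₀) (fun y hy => by simpa using (Finset.mem_filter.1 hy).2)]
      refine Finset.sum_le_sum fun i hi => ?_
      have hi0 := Finset.ne_of_mem_erase hi
      rcases (((Y.filter fun y => ¬ y.1.1 = i₀)).filter fun y => y.1.1 = i).eq_empty_or_nonempty
        with he | ⟨y, hy⟩
      · rw [he]
        simp
      · have hpos : 0 < finrank F ↥(S ⊓ Q i) := by
          simp only [Finset.mem_filter] at hy
          obtain ⟨⟨hyY, hy0⟩, rfl⟩ := hy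
          rw [Nat.pos_iff_ne_zero, Ne, Submodule.finrank_eq_zero]
          intro hbot
          have hm : vec y ∈ S ⊓ Q y.1.1 :=
            ⟨Submodule.subset_span ⟨y, hyY, hy0, rfl⟩, hxQ _ _ y.2.2⟩
          rw [hbot] at hm
          exact (hx y.1.1).ne_zero y.2.2 hm
        refine le_trans ?_ (Nat.le_mul_of_pos_left _ hpos)
        refine le_trans (Finset.card_le_card_of_injOn (fun y => y.1.2.1)
          (t := Finset.univ.filter fun c : Fin 2 => (c : ℕ) < s i) ?_ ?_) (hlow _)
        · intro y hy
          have hy := (Finset.mem_filter.1 hy).2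
          simpa [← hy] using y.2.1
        · intro y hy z hz hyz
          have hy := (Finset.mem_filter.1 hy).2
          have hz := (Finset.mem_filter.1 hz).2
          refine Subtype.ext (Prod.ext (hy.trans hz.symm) (Prod.ext hyz ?_))
          exact hE i hi0 (hy ▸ y.2.2) (hz ▸ z.2.2)
    have hGS : finrank F ↥(S ⊓ G 0) + finrank F ↥(S ⊓ G 1) ≤ finrank F ↥(S ⊓ Q i₀) * s i₀ := by
      have hc : ∀ c : Fin 2, finrank F ↥(S ⊓ G c) ≤
          if (c : ℕ) < s i₀ then finrank F ↥(S ⊓ Q i₀) else 0 := by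
        intro c
        split_ifs with hcs
        · refine Submodule.finrank_mono (inf_le_inf_left _ (Submodule.span_le.2 ?_))
          rintro _ ⟨h, hh, rfl⟩
          exact hxQ _ _ (hHE c h hh).2
        · have : G c = ⊥ := by
            rw [Submodule.span_eq_bot]
            rintro _ ⟨h, hh, rfl⟩
            exact absurd (hHE c h hh).1 hcs
          rw [this, inf_bot_eq, finrank_bot]
      calc _ = ∑ c, finrank F ↥(S ⊓ G c) := (Fin.sum_univ_two _).symm
        _ ≤ _ := Finset.sum_le_sum fun c _ => hc c
        _ = (Finset.univ.filter fun c : Fin 2 => (c : ℕ) < s i₀).card * finrank F ↥(S ⊓ Q i₀) := by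
          rw [← Finset.sum_filter, Finset.sum_const, smul_eq_mul]
        _ ≤ _ := by
          rw [mul_comm]
          exact Nat.mul_le_mul_left _ (hlow _)
    have hspan : (S ⊔ G 0).map (tensSingle F ι 0) ⊔ (S ⊔ G 1).map (tensSingle F ι 1) ≤
        Submodule.span F {v | ∃ y ∈ Y, v ∈ A y} := by
      have h : ∀ c, (S ⊔ G c).map (tensSingle F ι c) ≤
          Submodule.span F {v | ∃ y ∈ Y, v ∈ A y} := by
        intro c
        rw [Submodule.map_sup, sup_le_iff, Submodule.map_span_le, Submodule.map_span_le]
        constructor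
        · rintro _ ⟨y, hyY, hy0, rfl⟩
          refine Submodule.subset_span ⟨y, hyY, ?_⟩
          simp only [A, hy0, if_false]
          fin_cases c <;> simp
        · rintro _ ⟨h, hh, rfl⟩
          obtain ⟨y, hyY, hy⟩ := (Finset.mem_filter.1 hh).2
          refine Submodule.subset_span ⟨y, hyY, ?_⟩
          simp [A, hy, vec]
      exact sup_le (h 0) (h 1)
    have hfin := Submodule.finrank_mono hspan
    rw [finrank_tensSingle_sup fun c => S ⊔ G c] at hfin
    have e0 := Submodule.finrank_sup_add_finrank_inf_eq S (G 0)
    have e1 := Submodule.finrank_sup_add_finrank_inf_eq S (G 1)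
    rw [hG] at e0 e1
    have hcard := Finset.card_filter_add_card_filter_not (s := Y) (fun y : I => y.1.1 = i₀)
    have hS := hQ S
    rw [← Finset.add_sum_erase _ _ (Finset.mem_univ i₀)] at hS
    omega)
  have hq : ∀ y : I, ∃ q : Fin 2, f y = tensSingle F ι q (vec y) ∧ (y.1.1 = i₀ → q = y.1.2.1) := by
    intro y
    have := hfA y
    by_cases hy : y.1.1 = i₀
    · simp only [A, hy, if_true, Finset.mem_singleton] at this
      exact ⟨_, this, fun _ => rfl⟩
    · simp only [A, hy, if_false, Finset.mem_insert, Finset.mem_singleton] at this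
      rcases this with h | h
      exacts [⟨0, h, fun h' => absurd h' hy⟩, ⟨1, h, fun h' => absurd h' hy⟩]
  choose q hqf hq0 using hq
  let u : X → Fin 2 → Fin 2 → F := fun i c =>
    if h : ∃ y : I, y.1.1 = i ∧ y.1.2.1 = c then Pi.single (q h.choose) 1 else 0
  refine ⟨u, ?_⟩
  suffices h : (fun y : I => tens (u y.1.1 y.1.2.1) (x y.1.1 y.1.2.2)) = f from h ▸ hf
  ext1 y
  have hex : ∃ z : I, z.1.1 = y.1.1 ∧ z.1.2.1 = y.1.2.1 := ⟨y, rfl, rfl⟩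
  have hqy : q hex.choose = q y := by
    obtain ⟨h1, h2⟩ := hex.choose_spec
    by_cases hy : y.1.1 = i₀
    · rw [hq0 y hy, hq0 _ (h1.trans hy), h2]
    · have hmem : hex.choose.1.2.2 ∈ E y.1.1 := by
        have := hex.choose.2.2
        rwa [h1] at this
      have : hex.choose = y := Subtype.ext (Prod.ext h1 (Prod.ext h2 (hE _ hy hmem y.2.2)))
      rw [this]
  rw [hqf, tensSingle_apply, ← hqy]
  exact congrArg (fun w => tens w (vec y)) (dif_pos hex)

end TensorFamilies

section Levels

open Module

variable {F M N X : Type*} [Field F] [AddCommGroup M] [Module F M] [AddCommGroup N] [Module F N]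

/-- A block-triangular family with independent diagonal blocks is independent. -/
theorem linearIndependent_of_levels [Finite X] (v : X → M) (L : X → ℕ) (Φ : ℕ → M →ₗ[F] N)
    (h0 : ∀ k x, L x < k → Φ k (v x) = 0)
    (hli : ∀ k, LinearIndependent F fun x : {x // L x = k} => Φ k (v x)) :
    LinearIndependent F v := by
  classical
  have := Fintype.ofFinite X
  rw [Fintype.linearIndependent_iff]
  intro g hg
  by_contra! hne
  obtain ⟨y, hy⟩ := hne
  obtain ⟨x, hx, hmax⟩ := Finset.exists_max_image (Finset.univ.filter fun x => g x ≠ 0) L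
    ⟨y, by simpa using hy⟩
  refine (Finset.mem_filter.1 hx).2 (Fintype.linearIndependent_iff.1 (hli (L x))
    (fun z => g z) ?_ ⟨x, rfl⟩)
  have h := congrArg (Φ (L x)) hg
  rw [map_sum, map_zero, ← Finset.sum_filter_add_sum_filter_not _ (fun z => L z = L x),
    Finset.sum_eq_zero (s := Finset.univ.filter fun z => ¬ L z = L x), add_zero] at h
  · rw [← h, ← Finset.sum_subtype (Finset.univ.filter fun z => L z = L x) (by simp)
      (fun z => g z • Φ (L x) (v z))]
    simp
  · intro z hz
    rcases lt_or_gt_of_ne (Finset.mem_filter.1 hz).2 with h | h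
    · rw [map_smul, h0 _ _ h, smul_zero]
    · have : g z = 0 := by
        by_contra hgz
        exact absurd (hmax z (by simpa using hgz)) (not_le.2 h)
      rw [this, zero_smul, map_zero]

theorem finrank_map_add_finrank_inf_ker [FiniteDimensional F M] (φ : M →ₗ[F] N)
    (U : Submodule F M) :
    finrank F (U.map φ) + finrank F ↥(LinearMap.ker φ ⊓ U) = finrank F U := by
  rw [← LinearMap.finrank_range_add_finrank_ker (φ.domRestrict U), LinearMap.range_domRestrict,
    LinearMap.ker_domRestrict, ← LinearMap.ker_domRestrict, LinearMap.ker_domRestrict,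
    inf_comm, ← Submodule.finrank_map_subtype_eq, Submodule.map_comap_subtype]

/-- Contracting a tight subspace preserves the matching constraints. -/
theorem matching_constraint_map [FiniteDimensional F M] [FiniteDimensional F N] [Fintype X]
    (l : X → Submodule F M) (s : X → ℕ)
    (hl : ∀ S, ∑ i, finrank F ↥(S ⊓ l i) * s i ≤ 2 * finrank F S) (φ : M →ₗ[F] N)
    (hφ : ∑ i, finrank F ↥(LinearMap.ker φ ⊓ l i) * s i = 2 * finrank F (LinearMap.ker φ))
    (S : Submodule F N) : ∑ i, finrank F ↥(S ⊓ (l i).map φ) * s i ≤ 2 * finrank F S := by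
  have hker : LinearMap.ker φ ≤ S.comap φ := fun x hx => by
    rw [Submodule.mem_comap, LinearMap.mem_ker.1 hx]
    exact S.zero_mem
  have hT := finrank_map_add_finrank_inf_ker φ (S.comap φ)
  rw [inf_eq_left.2 hker] at hT
  have hTS := Submodule.finrank_mono (Submodule.map_comap_le φ S)
  have hi : ∀ i, finrank F ↥(S.comap φ ⊓ l i) =
      finrank F ↥(S ⊓ (l i).map φ) + finrank F ↥(LinearMap.ker φ ⊓ l i) := by
    intro i
    rw [← finrank_map_add_finrank_inf_ker φ (S.comap φ ⊓ l i), ← inf_assoc, inf_eq_left.2 hker,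
      inf_comm (S.comap φ), inf_comm S, Submodule.map_inf_eq_map_inf_comap]
  have h := hl (S.comap φ)
  simp only [hi, add_mul, Finset.sum_add_distrib] at h
  omega

end Levels

section GenericTensors

open Module

variable {K : Type*} [Field K] {n m : ℕ}

/-- The `c`-th column of the indeterminate matrix `Uᵢ`, tensored with `w`. -/
def genericTens (i : Fin m) (c : Fin 2) (w : Fin n → K) : Fin 2 × Fin n → FF2 K m :=
  tens (fun p => Uvar i p c) fun r => toFF2 K m (w r)

theorem genericTens_add_smul (i : Fin m) (c : Fin 2) (α β : K) (w w' : Fin n → K) :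
    genericTens i c (α • w + β • w') =
      toFF2 K m α • genericTens i c w + toFF2 K m β • genericTens i c w' := by
  ext x
  simp only [genericTens, tens, Pi.add_apply, Pi.smul_apply, smul_eq_mul, map_add, map_mul]
  ring

/-- The endomorphism `id ⊗ φ` over the function field. -/
def tensMap (m : ℕ) (φ : (Fin n → K) →ₗ[K] (Fin n → K)) :
    (Fin 2 × Fin n → FF2 K m) →ₗ[FF2 K m] (Fin 2 × Fin n → FF2 K m) where
  toFun z x := (((LinearMap.toMatrix' φ).map (toFF2 K m)) *ᵥ fun r => z (x.1, r)) x.2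
  map_add' z w := by
    ext x
    exact congrFun (mulVec_add _ (fun r => z (x.1, r)) fun r => w (x.1, r)) x.2
  map_smul' c z := by
    ext x
    exact congrFun (mulVec_smul _ c fun r => z (x.1, r)) x.2

theorem tensMap_genericTens (φ : (Fin n → K) →ₗ[K] (Fin n → K)) (i : Fin m) (c : Fin 2)
    (w : Fin n → K) : tensMap m φ (genericTens i c w) = genericTens i c (φ w) := by
  ext x
  change (((LinearMap.toMatrix' φ).map (toFF2 K m)) *ᵥ
    ((Uvar i x.1 c : FF2 K m) • (toFF2 K m ∘ w))) x.2 = Uvar i x.1 c * toFF2 K m (φ w x.2)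
  rw [mulVec_smul, Pi.smul_apply, smul_eq_mul, ← RingHom.map_mulVec, LinearMap.toMatrix'_mulVec]

/-- Generic tensors are independent as soon as some choice of the columns makes them so. -/
theorem linearIndependent_genericTens_of_specialization {Y : Type*} [Finite Y]
    (u : Fin m → Fin 2 → Fin 2 → K) (i : Y → Fin m) (c : Y → Fin 2) (w : Y → Fin n → K)
    (h : LinearIndependent K fun y => tens (u (i y) (c y)) (w y)) :
    LinearIndependent (FF2 K m) fun y => genericTens (i y) (c y) (w y) := by
  have := Fintype.ofFinite Y
  have key := linearIndependent_of_specialization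
    (MvPolynomial.eval fun x : Fin m × Fin 2 × Fin 2 => u x.1 x.2.2 x.2.1)
    (algebraMap (MvPolynomial (Fin m × Fin 2 × Fin 2) K) (FF2 K m))
    (IsFractionRing.injective _ _)
    (fun (y : Y) (x : Fin 2 × Fin n) => MvPolynomial.X (i y, x.1, c y) * MvPolynomial.C (w y x.2))
    (by
      simp only [map_mul, MvPolynomial.eval_X, MvPolynomial.eval_C]
      exact h)
  simp only [map_mul] at key
  exact key

/-- Generic tensors attached to a fractional matching with a suitable tight chain are
independent. -/
theorem linearIndependent_genericTens (l : Fin m → Submodule K (Fin n → K)) (s : Fin m → ℕ)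
    (hl : ∀ S, ∑ i, finrank K ↥(S ⊓ l i) * s i ≤ 2 * finrank K S)
    (v : Fin m → Fin 2 → Fin n → K) (hv : ∀ i, LinearIndependent K (v i))
    (hvl : ∀ i h, v i h ∈ l i) (S : ℕ → Submodule K (Fin n → K)) (L : Fin m → Fin 2 → ℕ)
    (hL : ∀ i h k, v i h ∈ S k ↔ L i h < k)
    (hfin : ∀ i k, finrank K ↥(S k ⊓ l i) = Nat.card {h // v i h ∈ S k})
    (htight : ∀ i h, s i ≠ 0 →
      ∑ j, finrank K ↥(S (L i h) ⊓ l j) * s j = 2 * finrank K (S (L i h)))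
    (huniq : ∀ i i' k, s i ≠ 0 → s i' ≠ 0 → (∀ h, L i h = k) → (∀ h, L i' h = k) → i = i') :
    LinearIndependent (FF2 K m) fun y : {y : Fin m × Fin 2 × Fin 2 // (y.2.1 : ℕ) < s y.1} =>
      genericTens y.1.1 y.1.2.1 (v y.1.1 y.1.2.2) := by
  choose φ hφ using fun k => exists_endomorphism_ker_eq (S k)
  refine linearIndependent_of_levels _ (fun y => L y.1.1 y.1.2.2) (fun k => tensMap m (φ k)) ?_ ?_
  · intro k y hy
    have : φ k (v y.1.1 y.1.2.2) = 0 := by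
      rw [← LinearMap.mem_ker, hφ]
      exact (hL _ _ _).2 hy
    rw [tensMap_genericTens, this]
    ext x
    simp [genericTens, tens]
  intro k
  by_cases hex : ∃ i h, s i ≠ 0 ∧ L i h = k
  swap
  · have : IsEmpty {y : {y : Fin m × Fin 2 × Fin 2 // (y.2.1 : ℕ) < s y.1} //
        L y.1.1 y.1.2.2 = k} :=
      ⟨fun y => hex ⟨y.1.1.1, y.1.1.2.2, (Nat.zero_lt_of_lt y.1.2).ne', y.2⟩⟩
    exact linearIndependent_empty_type
  obtain ⟨i₁, h₁, hs₁, hk⟩ := hex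
  let E : Fin m → Set (Fin 2) := fun i => {h | s i ≠ 0 ∧ L i h = k}
  have hE2 : ∀ i, ¬ (E i).Subsingleton → s i ≠ 0 ∧ ∀ h, L i h = k := by
    intro i hi
    rw [Set.not_subsingleton_iff] at hi
    obtain ⟨h, hh, h', hh', hne⟩ := hi
    refine ⟨hh.1, fun h'' => ?_⟩
    have : h'' = h ∨ h'' = h' := by omega
    rcases this with rfl | rfl
    exacts [hh.2, hh'.2]
  obtain ⟨i₀, hi₀⟩ : ∃ i₀, ∀ i ≠ i₀, (E i).Subsingleton := by
    by_cases hloop : ∃ i, ¬ (E i).Subsingleton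
    · obtain ⟨i₀, h0⟩ := hloop
      refine ⟨i₀, fun i hi => by_contra fun h => hi ?_⟩
      exact huniq i i₀ k (hE2 i h).1 (hE2 i₀ h0).1 (hE2 i h).2 (hE2 i₀ h0).2
    · push Not at hloop
      exact ⟨i₁, fun i _ => hloop i⟩
  have hli : ∀ i, LinearIndepOn K (fun h => φ k (v i h)) (E i) := by
    intro i
    by_cases hsub : (E i).Subsingleton
    · rcases hsub.eq_empty_or_singleton with he | ⟨h, he⟩
      · rw [he]
        exact linearIndepOn_empty _ _
      · rw [he]
        refine LinearIndepOn.singleton fun h0 => ?_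
        rw [← LinearMap.mem_ker, hφ, hL] at h0
        have : h ∈ E i := he ▸ rfl
        exact h0.ne this.2
    · have hbot : S k ⊓ l i = ⊥ := by
        rw [← Submodule.finrank_eq_zero (R := K), hfin]
        have : IsEmpty {h // v i h ∈ S k} :=
          ⟨fun h => ((hL _ _ _).1 h.2).ne ((hE2 i hsub).2 h.1)⟩
        exact Nat.card_of_isEmpty
      have : LinearIndependent K (φ k ∘ v i) := by
        refine (hv i).map ?_
        rw [hφ, disjoint_iff, eq_bot_iff, ← hbot, inf_comm]
        refine inf_le_inf_left _ (Submodule.span_le.2 ?_)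
        rintro _ ⟨h, rfl⟩
        exact hvl i h
      exact this.linearIndepOn (E i)
  obtain ⟨u, hu⟩ := exists_independent_tens (fun i => (l i).map (φ k)) s
    (matching_constraint_map l s hl (φ k) (by rw [hφ, ← hk]; exact htight i₁ h₁ hs₁))
    (fun i h => φ k (v i h)) E (fun i h _ => Submodule.mem_map_of_mem (hvl i h)) hli i₀ hi₀
  have hgen := linearIndependent_genericTens_of_specialization u _ _ _ hu
  simp only [tensMap_genericTens]
  exact hgen.comp (fun y : {y : {y : Fin m × Fin 2 × Fin 2 // (y.2.1 : ℕ) < s y.1} //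
      L y.1.1 y.1.2.2 = k} => ⟨y.1.1, y.1.2, (Nat.zero_lt_of_lt y.1.2).ne', y.2⟩)
    (fun y z hyz => by
      have := congrArg Subtype.val hyz
      exact Subtype.ext (Subtype.ext this))

end GenericTensors

section UpperBound

open Module

theorem skew_unimodular {F ι : Type*} [Field F] (p q : ι → F) {c d c' d' : F}
    (h : c * d' - d * c' = 1) : skew (c • p + d • q) (c' • p + d' • q) = skew p q := by
  ext i j
  simp only [skew, vecMulVec_apply, Matrix.sub_apply, Pi.add_apply, Pi.smul_apply, smul_eq_mul]
  linear_combination (p i * q j - q i * p j) * h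

variable {K : Type*} [Field K] {n m : ℕ}

/-- The pairs `(i, c)` indexing the columns of the matrices `Uᵢ` with `sᵢ` columns. -/
def columns (s : Fin m → ℕ) : Finset (Fin m × Fin 2) :=
  Finset.univ.filter fun x => (x.2 : ℕ) < s x.1

theorem mem_columns {s : Fin m → ℕ} {x : Fin m × Fin 2} : x ∈ columns s ↔ (x.2 : ℕ) < s x.1 := by
  simp [columns]

theorem A2_eq_sum_skew (a b : Fin m → Fin n → K) (t : Fin m → ℕ) :
    A2 a b t = ∑ x ∈ columns t, skew (genericTens x.1 x.2 (a x.1)) (genericTens x.1 x.2 (b x.1)) := by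
  rw [columns, Finset.sum_filter, ← Finset.univ_product_univ, Finset.sum_product, A2]
  refine Finset.sum_congr rfl fun i _ => ?_
  ext ⟨p, r⟩ ⟨q, r'⟩
  simp only [kroneckerMap_apply, Ymat, of_apply, map_apply, wedge, Matrix.sub_apply, vecMulVec_apply,
    map_sub, map_mul, Finset.sum_mul, Matrix.sum_apply]
  refine Finset.sum_congr rfl fun c _ => ?_
  split_ifs
  · simp only [skew, Matrix.sub_apply, vecMulVec_apply, genericTens, tens]
    ring
  · simp

theorem A2_eq_sum_skew_of_unimodular (a b : Fin m → Fin n → K) (t : Fin m → ℕ)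
    (v : Fin m → Fin 2 → Fin n → K) (c d c' d' : Fin m → K)
    (hv0 : ∀ i, v i 0 = c i • a i + d i • b i) (hv1 : ∀ i, v i 1 = c' i • a i + d' i • b i)
    (hdet : ∀ i, c i * d' i - d i * c' i = 1) :
    A2 a b t =
      ∑ x ∈ columns t, skew (genericTens x.1 x.2 (v x.1 0)) (genericTens x.1 x.2 (v x.1 1)) := by
  rw [A2_eq_sum_skew]
  refine Finset.sum_congr rfl fun x _ => ?_
  rw [hv0, hv1, genericTens_add_smul, genericTens_add_smul, skew_unimodular]
  rw [← map_mul, ← map_mul, ← map_sub, hdet, map_one]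

/-- Extension of scalars does not increase the dimension of a subspace. -/
theorem finrank_span_image_le {F : Type*} [Field F] (σ : K →+* F) (S : Submodule K (Fin n → K)) :
    finrank F (Submodule.span F ((fun (w : Fin n → K) r => σ (w r)) '' (S : Set (Fin n → K)))) ≤
      finrank K S := by
  let β := finBasis K S
  have hle : Submodule.span F ((fun (w : Fin n → K) r => σ (w r)) '' (S : Set (Fin n → K))) ≤
      Submodule.span F (Set.range fun j r => σ ((β j : Fin n → K) r)) := by
    rw [Submodule.span_le]
    rintro _ ⟨w, hw, rfl⟩
    have h : w = ∑ j, β.repr ⟨w, hw⟩ j • (β j : Fin n → K) := by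
      have := congrArg Subtype.val (β.sum_repr ⟨w, hw⟩)
      simpa only [Submodule.coe_sum, Submodule.coe_smul] using this.symm
    have h' : (fun r => σ (w r)) =
        ∑ j, σ (β.repr ⟨w, hw⟩ j) • fun r => σ ((β j : Fin n → K) r) := by
      ext r
      conv_lhs => rw [h]
      simp
    change (fun r => σ (w r)) ∈ _
    rw [h']
    exact Submodule.sum_mem _ fun j _ => Submodule.smul_mem _ _ (Submodule.subset_span ⟨j, rfl⟩)
  refine (Submodule.finrank_mono hle).trans ((finrank_range_le_card _).trans ?_)
  rw [Fintype.card_fin]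

/-- Independent tensors over vectors of a subspace `S` number at most `2 dim S`. -/
theorem card_le_of_genericTens_mem {Y : Type*} [Fintype Y] (i : Y → Fin m) (c : Y → Fin 2)
    (w : Y → Fin n → K) (h : LinearIndependent (FF2 K m) fun y => genericTens (i y) (c y) (w y))
    (S : Submodule K (Fin n → K)) (hw : ∀ y, w y ∈ S) : Fintype.card Y ≤ 2 * finrank K S := by
  let S' := Submodule.span (FF2 K m)
    ((fun (w : Fin n → K) r => toFF2 K m (w r)) '' (S : Set (Fin n → K)))
  have hle : Submodule.span (FF2 K m) (Set.range fun y => genericTens (i y) (c y) (w y)) ≤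
      S'.map (tensSingle (FF2 K m) (Fin n) 0) ⊔ S'.map (tensSingle (FF2 K m) (Fin n) 1) := by
    rw [Submodule.span_le]
    rintro _ ⟨y, rfl⟩
    have hy : (fun r => toFF2 K m (w y r)) ∈ S' := Submodule.subset_span ⟨w y, hw y, rfl⟩
    change genericTens (i y) (c y) (w y) ∈ _
    rw [genericTens, tens_eq_add]
    exact Submodule.add_mem_sup (Submodule.smul_mem _ _ (Submodule.mem_map_of_mem hy))
      (Submodule.smul_mem _ _ (Submodule.mem_map_of_mem hy))
  have h1 := finrank_span_eq_card h
  have h2 := Submodule.finrank_mono hle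
  rw [finrank_tensSingle_sup fun _ => S'] at h2
  have h3 : finrank (FF2 K m) S' ≤ finrank K S := finrank_span_image_le (toFF2 K m) S
  omega

theorem card_columns_filter_le (s : Fin m → ℕ) (i : Fin m) :
    ((columns s).filter fun x => x.1 = i).card ≤ s i := by
  have := Finset.card_le_card_of_injOn (s := (columns s).filter fun x => x.1 = i)
    (t := Finset.range (s i)) (fun x => (x.2 : ℕ))
    (fun x hx => by
      obtain ⟨h1, h2⟩ := Finset.mem_filter.1 hx
      simpa [← h2] using mem_columns.1 h1)
    (fun x hx y hy hxy => Prod.ext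
      ((Finset.mem_filter.1 hx).2.trans (Finset.mem_filter.1 hy).2.symm) (Fin.ext hxy))
  rwa [Finset.card_range] at this

/-- The rank of `A2 a b t` is bounded by the size of some fractional matching below `t / 2`. -/
theorem exists_fracMatching_rank_le (a b : Fin m → Fin n → K)
    (hab : ∀ i, LinearIndependent K ![a i, b i]) (t : Fin m → ℕ) :
    ∃ z : Fin m → ℝ, IsFracMatching a b z ∧ (∀ i, z i ≤ (t i : ℝ) / 2) ∧
      ((A2 a b t).rank : ℝ) ≤ 4 * ∑ i, z i := by
  classical
  obtain ⟨M, hMJ, hM, hrank⟩ := exists_independent_lines (F := FF2 K m) (columns t)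
    fun x h => genericTens x.1 x.2 (if h = 0 then a x.1 else b x.1)
  simp only [one_ne_zero, if_true, if_false] at hrank
  rw [← A2_eq_sum_skew] at hrank
  have hcard : M.card = ∑ i, (M.filter fun x => x.1 = i).card :=
    Finset.card_eq_sum_card_fiberwise fun _ _ => Finset.mem_coe.2 (Finset.mem_univ _)
  refine ⟨fun i => ((M.filter fun x => x.1 = i).card : ℝ) / 2, ⟨fun i => by positivity, ?_⟩, ?_, ?_⟩
  · intro S
    let C : ℕ → Submodule K (Fin n → K) := fun k => if k = 0 then ⊥ else if k = 1 then S else ⊤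
    have hC : Monotone C := by
      refine monotone_nat_of_le_succ fun k => ?_
      rcases k with _ | _ | k <;> simp [C]
    choose w c d c' d' hw0 hw1 hdet hwli hwspan hwfin using fun i =>
      exists_adapted_basis (a i) (b i) (hab i) C hC (N := 2) (by simp [C])
    let g : M × Fin 2 → Fin 2 × Fin n → FF2 K m := fun x =>
      genericTens x.1.1.1 x.1.1.2 (w x.1.1.1 x.2)
    have hgmem : ∀ (x : M) h, genericTens x.1.1 x.1.2 (w x.1.1 h) ∈
        Submodule.span (FF2 K m) (Set.range g) := fun x h =>
      Submodule.subset_span ⟨(x, h), rfl⟩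
    have hg : LinearIndependent (FF2 K m) g := by
      rw [linearIndependent_iff_card_le_finrank_span, ← finrank_span_eq_card hM]
      refine Submodule.finrank_mono (Submodule.span_le.2 ?_)
      rintro _ ⟨⟨x, h⟩, rfl⟩
      have hmem : (if h = 0 then a x.1.1 else b x.1.1) ∈
          Submodule.span K (Set.range (w x.1.1)) := by
        rw [hwspan]
        split_ifs <;> exact Submodule.subset_span (by simp)
      have hr : Set.range (w x.1.1) = {w x.1.1 0, w x.1.1 1} := by
        ext y
        simp [Fin.exists_fin_two, eq_comm]
      rw [hr] at hmem
      obtain ⟨α, β, hαβ⟩ := Submodule.mem_span_pair.1 hmem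
      change genericTens x.1.1 x.1.2 (if h = 0 then a x.1.1 else b x.1.1) ∈ _
      rw [← hαβ, genericTens_add_smul]
      exact Submodule.add_mem _ (Submodule.smul_mem _ _ (hgmem x 0))
        (Submodule.smul_mem _ _ (hgmem x 1))
    have hfin : ∀ i, finrank K ↥(S ⊓ line (a i) (b i)) =
        ∑ h, if w i h ∈ S then 1 else 0 := by
      intro i
      have := hwfin i 1
      have hC1 : C 1 = S := by simp [C]
      rwa [hC1, Nat.card_eq_fintype_card, Fintype.card_subtype, Finset.card_filter] at this
    have hle := card_le_of_genericTens_mem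
      (fun x : {x : M × Fin 2 // w x.1.1.1 x.2 ∈ S} => x.1.1.1.1) (fun x => x.1.1.1.2)
      (fun x => w x.1.1.1.1 x.1.2)
      (hg.comp Subtype.val Subtype.val_injective) S fun x => x.2
    have hsum : Fintype.card {x : M × Fin 2 // w x.1.1.1 x.2 ∈ S} =
        ∑ i, finrank K ↥(S ⊓ line (a i) (b i)) * (M.filter fun x => x.1 = i).card := by
      rw [Fintype.card_subtype, Finset.card_filter, ← Finset.univ_product_univ,
        Finset.sum_product, Finset.sum_coe_sort M fun x => ∑ h, if w x.1 h ∈ S then 1 else 0,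
        ← Finset.sum_fiberwise M fun x => x.1]
      refine Finset.sum_congr rfl fun i _ => ?_
      rw [hfin, mul_comm, ← smul_eq_mul, ← Finset.sum_const]
      refine Finset.sum_congr rfl fun x hx => ?_
      rw [(Finset.mem_filter.1 hx).2]
    rw [hsum] at hle
    have hle' : ((∑ i, finrank K ↥(S ⊓ line (a i) (b i)) *
        (M.filter fun x => x.1 = i).card : ℕ) : ℝ) ≤ 2 * finrank K S := by exact_mod_cast hle
    push_cast at hle'
    simp only [mul_div_assoc']
    rw [← Finset.sum_div]
    linarith
  · intro i
    have : (M.filter fun x => x.1 = i).card ≤ t i :=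
      (Finset.card_le_card (Finset.filter_subset_filter _ hMJ)).trans (card_columns_filter_le t i)
    have : ((M.filter fun x => x.1 = i).card : ℝ) ≤ t i := by exact_mod_cast this
    simp only
    linarith
  · rw [← Finset.sum_div, ← Nat.cast_sum, ← hcard]
    have : ((A2 a b t).rank : ℝ) ≤ 2 * M.card := by exact_mod_cast hrank
    linarith

end UpperBound

section LowerBound

open Module

variable {K : Type*} [Field K] {n m : ℕ}

theorem rank_A2_mono (a b : Fin m → Fin n → K) {s t : Fin m → ℕ} (hst : ∀ i, s i ≤ t i) :
    (A2 a b s).rank ≤ (A2 a b t).rank := by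
  let R := MvPolynomial (Fin m × Fin 2 × Fin 2) K
  let P : Matrix (Fin 2 × Fin n) (Fin 2 × Fin n) R := Matrix.of fun x y =>
    ∑ i, (∑ c : Fin 2, if (c : ℕ) < t i then
      MvPolynomial.X (i, x.1, c) * MvPolynomial.X (i, y.1, c) else 0) *
        MvPolynomial.C (wedge (a i) (b i) x.2 y.2)
  have hP : ∀ x y, P x y = ∑ i, (∑ c : Fin 2, if (c : ℕ) < t i then
      MvPolynomial.X (i, x.1, c) * MvPolynomial.X (i, y.1, c) else 0) *
        MvPolynomial.C (wedge (a i) (b i) x.2 y.2) := fun _ _ => rfl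
  let ψ := algebraMap R (FF2 K m)
  let φ : R →+* FF2 K m := MvPolynomial.eval₂Hom (toFF2 K m) fun z : Fin m × Fin 2 × Fin 2 =>
    if (z.2.2 : ℕ) < s z.1 then Uvar z.1 z.2.1 z.2.2 else 0
  have hψ : P.map ψ = A2 a b t := by
    ext ⟨p, r⟩ ⟨q, r'⟩
    rw [A2, Matrix.sum_apply, map_apply, hP, map_sum]
    refine Finset.sum_congr rfl fun i _ => ?_
    rw [map_mul, map_sum, kroneckerMap_apply, Ymat, of_apply]
    refine congrArg₂ _ (Finset.sum_congr rfl fun c _ => ?_) rfl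
    split_ifs
    · exact map_mul _ _ _
    · exact map_zero _
  have hφ : P.map φ = A2 a b s := by
    ext ⟨p, r⟩ ⟨q, r'⟩
    rw [A2, Matrix.sum_apply, map_apply, hP, map_sum]
    refine Finset.sum_congr rfl fun i _ => ?_
    rw [map_mul, map_sum, kroneckerMap_apply, Ymat, of_apply]
    refine congrArg₂ _ (Finset.sum_congr rfl fun c _ => ?_) (MvPolynomial.eval₂Hom_C _ _ _)
    have hX : ∀ p, φ (MvPolynomial.X (i, p, c)) = if (c : ℕ) < s i then Uvar i p c else 0 :=
      fun p => MvPolynomial.eval₂Hom_X' _ _ _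
    by_cases hc : (c : ℕ) < s i
    · rw [if_pos (hc.trans_le (hst i)), if_pos hc, map_mul, hX, hX, if_pos hc, if_pos hc]
    · rw [if_neg hc, apply_ite φ, map_mul, hX, if_neg hc, zero_mul, map_zero, ite_self]
  rw [← hφ, ← hψ]
  exact rank_map_le_of_specialization φ ψ (IsFractionRing.injective _ _) P

theorem card_columns {s : Fin m → ℕ} (hs : ∀ i, s i ≤ 2) : (columns s).card = ∑ i, s i := by
  rw [columns, Finset.card_filter, ← Finset.univ_product_univ, Finset.sum_product]
  refine Finset.sum_congr rfl fun i _ => ?_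
  have := hs i
  change (∑ c : Fin 2, if (c : ℕ) < s i then 1 else 0) = s i
  rw [Fin.sum_univ_two, Fin.val_zero, Fin.val_one]
  split_ifs <;> omega

/-- Every extreme point below `t / 2` bounds the rank of `A2 a b t` from below. -/
theorem four_mul_sum_le_rank_of_extreme (a b : Fin m → Fin n → K)
    (hab : ∀ i, LinearIndependent K ![a i, b i]) (t : Fin m → ℕ) (ht : ∀ i, t i ≤ 2)
    (z : Fin m → ℝ) (hz : z ∈ Set.extremePoints ℝ {z : Fin m → ℝ | IsFracMatching a b z})
    (hzt : ∀ i, z i ≤ (t i : ℝ) / 2) : 4 * ∑ i, z i ≤ ((A2 a b t).rank : ℝ) := by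
  classical
  let l : Fin m → Submodule K (Fin n → K) := fun i => line (a i) (b i)
  have hzl : z ∈ Set.extremePoints ℝ {z : Fin m → ℝ | (∀ i, 0 ≤ z i) ∧
    ∀ S, lineWeight l z S ≤ finrank K S} := hz
  have hz0 : ∀ i, 0 ≤ z i := hzl.1.1
  have hP : ∀ S, lineWeight l z S ≤ finrank K S := hzl.1.2
  obtain ⟨S, h0, hmono, ⟨N, hN⟩, hS, hcov⟩ := exists_maximal_chain (IsTight l z) (isTight_bot l z)
  choose v c d c' d' hv0 hv1 hdet hvli hvspan hvfin using fun i =>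
    exists_adapted_basis (a i) (b i) (hab i) S hmono hN
  choose L hL using fun i h => exists_level S h0 hmono hN (v i h) ((hvli i).ne_zero h)
  have hlw : ∀ w k, lineWeight l w (S k) = ∑ x : Fin m × Fin 2 with L x.1 x.2 < k, w x.1 := by
    intro w k
    rw [Finset.sum_filter, ← Finset.univ_product_univ, Finset.sum_product]
    refine Finset.sum_congr rfl fun i _ => ?_
    have := hvfin i k
    simp only [hL] at this
    rw [Nat.card_eq_fintype_card, Fintype.card_subtype] at this
    change _ = ∑ h : Fin 2, if L i h < k then w i else 0
    rw [← Finset.sum_filter, Finset.sum_const, nsmul_eq_mul, ← this]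
    rfl
  have hsucc : ∀ w k, lineWeight l w (S (k + 1)) =
      lineWeight l w (S k) + ∑ x : Fin m × Fin 2 with L x.1 x.2 = k, w x.1 := by
    intro w k
    rw [hlw, hlw, ← Finset.sum_union]
    · congr 1
      ext x
      simp only [Finset.mem_filter, Finset.mem_union, Finset.mem_univ, true_and]
      omega
    · rw [Finset.disjoint_filter]
      omega
  have hprev : ∀ k, IsTight l z (S (k + 1)) → IsTight l z (S k) := by
    intro k hk
    rcases hS k with h | h
    · exact h
    · have : S (k + 1) = S k := by rw [h, eq_top_iff, ← h]; exact hmono k.le_succ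
      rwa [this] at hk
  have hinj : ∀ w : Fin m → ℝ, (∀ i, z i = 0 → w i = 0) →
      (∀ k, IsTight l z (S (k + 1)) →
        ∑ x : Fin m × Fin 2 with L x.1 x.2 = k, w x.1 = 0) → w = 0 := by
    intro w hw hrow
    have hzero : ∀ k, IsTight l z (S k) → lineWeight l w (S k) = 0 := by
      intro k
      induction k with
      | zero => exact fun _ => by rw [h0, lineWeight_bot]
      | succ k ih => exact fun hk => by rw [hsucc, ih (hprev k hk), hrow k hk, add_zero]
    exact eq_zero_of_extreme hzl w hw fun T hT =>
      lineWeight_eq_zero_of_chain hz0 hP h0 hmono hN hS hcov w hw hzero T hT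
  have hhalf : ∀ i, ∃ s : ℕ, z i = (s : ℝ) / 2 := by
    intro i
    obtain ⟨s, hs⟩ := half_integral_of_determined z (fun x => L x.1 x.2)
      (fun k => IsTight l z (S (k + 1)))
      (fun k hk => ⟨finrank K (S (k + 1)) - finrank K (S k), by
        have h1 := hsucc z k
        have h2 : lineWeight l z (S k) = _ := hprev k hk
        have h3 : lineWeight l z (S (k + 1)) = _ := hk
        push_cast
        linarith⟩) hinj i
    have hnn : 0 ≤ s := by
      have := hz0 i
      rw [hs] at this
      have : (0 : ℝ) ≤ s := by linarith
      exact_mod_cast this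
    exact ⟨s.toNat, by rw [hs, ← Int.cast_natCast, Int.toNat_of_nonneg hnn]⟩
  choose s hs using hhalf
  have hst : ∀ i, s i ≤ t i := by
    intro i
    have := hzt i
    rw [hs] at this
    have : (s i : ℝ) ≤ t i := by linarith
    exact_mod_cast this
  have hweight : ∀ T : Submodule K (Fin n → K),
      ((∑ i, finrank K ↥(T ⊓ l i) * s i : ℕ) : ℝ) = 2 * lineWeight l z T := by
    intro T
    rw [lineWeight, Finset.mul_sum]
    push_cast
    refine Finset.sum_congr rfl fun i _ => ?_
    rw [hs]
    ring
  have hli := linearIndependent_genericTens l s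
    (fun T => by
      have : ((∑ i, finrank K ↥(T ⊓ l i) * s i : ℕ) : ℝ) ≤ 2 * finrank K T := by
        rw [hweight]
        linarith [hP T]
      exact_mod_cast this)
    v hvli
    (fun i h => by
      change v i h ∈ Submodule.span K {a i, b i}
      rw [← hvspan]
      exact Submodule.subset_span ⟨h, rfl⟩)
    S L hL hvfin
    (fun i h hi => by
      have htight : IsTight l z (S (L i h)) := (hS _).resolve_right fun htop =>
        ((hL i h _).1 (htop ▸ Submodule.mem_top)).false
      have : ((∑ j, finrank K ↥(S (L i h) ⊓ l j) * s j : ℕ) : ℝ) =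
          2 * finrank K (S (L i h)) := by
        rw [hweight, htight]
      exact_mod_cast this)
    (fun i i' k hi hi' hLi hLi' => by
      by_contra hne
      have hzi : ∀ j, s j ≠ 0 → z j ≠ 0 := fun j hj h => hj (by
        rw [hs] at h
        have : (s j : ℝ) = 0 := by linarith
        exact_mod_cast this)
      have hw := hinj (Pi.single i 1 - Pi.single i' 1)
        (fun j hj => by
          have h1 : j ≠ i := by
            rintro rfl
            exact hzi _ hi hj
          have h2 : j ≠ i' := by
            rintro rfl
            exact hzi _ hi' hj
          simp [h1, h2])
        (fun k' _ => by
          rw [Finset.sum_filter, ← Finset.univ_product_univ, Finset.sum_product]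
          have hj : ∀ j, (∑ h, if L j h = k' then
              (Pi.single i 1 - Pi.single i' 1 : Fin m → ℝ) j else 0) =
              (Pi.single i 1 - Pi.single i' 1 : Fin m → ℝ) j *
                ∑ h, if L j h = k' then 1 else 0 := by
            intro j
            rw [Finset.mul_sum]
            simp only [mul_ite, mul_one, mul_zero]
          refine (Finset.sum_congr rfl fun j _ => hj j).trans ?_
          simp only [Pi.sub_apply, sub_mul, Finset.sum_sub_distrib, Pi.single_apply, ite_mul,
            one_mul, zero_mul, Finset.sum_ite_eq', Finset.mem_univ, if_true, hLi, hLi', sub_self])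
      have := congrFun hw i
      simp [hne] at this)
  have hrank := two_mul_card_le_rank_sum_skew
    (fun (x : columns s) h => genericTens x.1.1 x.1.2 (v x.1.1 h))
    (hli.comp (fun x : columns s × Fin 2 => ⟨(x.1.1.1, x.1.1.2, x.2), mem_columns.1 x.1.2⟩)
      (fun x y hxy => by
        simp only [Subtype.mk.injEq, Prod.mk.injEq] at hxy
        exact Prod.ext (Subtype.ext (Prod.ext hxy.1 hxy.2.1)) hxy.2.2))
  rw [Finset.sum_coe_sort (columns s) fun x =>
      skew (genericTens x.1 x.2 (v x.1 0)) (genericTens x.1 x.2 (v x.1 1)),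
    ← A2_eq_sum_skew_of_unimodular a b s v c d c' d' hv0 hv1 hdet, Fintype.card_coe,
    card_columns fun i => (hst i).trans (ht i)] at hrank
  have hle : ((2 * ∑ i, s i : ℕ) : ℝ) ≤ (A2 a b t).rank := by
    exact_mod_cast hrank.trans (rank_A2_mono a b hst)
  push_cast at hle
  simp only [hs]
  rw [← Finset.sum_div]
  linarith

end LowerBound

/-- For a half-integral `y` (encoded by `t : Fin m → ℕ`, `yᵢ = tᵢ / 2`),
`ρ_A(y) ≤ 4 · max {|z| : z ∈ P, z ≤ y}`; and if some extreme point `z*` of `P` with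
`z* ≤ y` attains the maximum, then equality holds. -/
theorem rank_A2_le_four_mul_max_and_eq_of_extreme
    {K : Type*} [Field K] {n m : ℕ} (hn : 0 < n) (hm : 0 < m)
    (a b : Fin m → Fin n → K) (hab : ∀ i, LinearIndependent K ![a i, b i])
    (t : Fin m → ℕ) (ht : ∀ i, t i ≤ 2) :
    (((A2 a b t).rank : ℝ) ≤
      4 * sSup {r : ℝ | ∃ z : Fin m → ℝ, IsFracMatching a b z ∧
        (∀ i, z i ≤ (t i : ℝ) / 2) ∧ r = ∑ i, z i}) ∧
    ((∃ zs : Fin m → ℝ,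
        zs ∈ Set.extremePoints ℝ {z : Fin m → ℝ | IsFracMatching a b z} ∧
        (∀ i, zs i ≤ (t i : ℝ) / 2) ∧
        ∑ i, zs i = sSup {r : ℝ | ∃ z : Fin m → ℝ, IsFracMatching a b z ∧
          (∀ i, z i ≤ (t i : ℝ) / 2) ∧ r = ∑ i, z i}) →
      ((A2 a b t).rank : ℝ) =
        4 * sSup {r : ℝ | ∃ z : Fin m → ℝ, IsFracMatching a b z ∧
          (∀ i, z i ≤ (t i : ℝ) / 2) ∧ r = ∑ i, z i}) := by
  set A : Set ℝ := {r : ℝ | ∃ z : Fin m → ℝ, IsFracMatching a b z ∧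
    (∀ i, z i ≤ (t i : ℝ) / 2) ∧ r = ∑ i, z i} with hA
  have hbdd : BddAbove A := by
    refine ⟨∑ i, (t i : ℝ) / 2, ?_⟩
    rintro _ ⟨z, -, hz, rfl⟩
    exact Finset.sum_le_sum fun i _ => hz i
  have hle : ((A2 a b t).rank : ℝ) ≤ 4 * sSup A := by
    obtain ⟨z, hz, hzt, hrank⟩ := exists_fracMatching_rank_le a b hab t
    have := le_csSup hbdd ⟨z, hz, hzt, rfl⟩
    linarith
  refine ⟨hle, ?_⟩
  rintro ⟨z, hz, hzt, hmax⟩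
  refine le_antisymm hle ?_
  rw [← hmax]
  exact four_mul_sum_le_rank_of_extreme a b hab t ht z hz hzt
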